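/- arXiv:2104.06741 — 4 statements merged into one kernel-verified Lean document; each statement's English description precedes it below -/
import Mathlib

section
/- Fix a prime p and fix an algebraic closure ℚ̄ of ℚ. Let ℤ[ζ_{∞'}] be the subring of ℚ̄ generated by all roots of unity of order coprime to p, and R_p = ℤ[ζ_{∞'}]/pℤ[ζ_{∞'}]. Then R_p and the countable power 𝔽̄_p^ℕ are existentially equivalent in the language of rings: for all m, n ∈ ℕ and all polynomials f_1,…,f_n, g_1,…,g_n ∈ ℤ[x_1,…,x_m], the system f_1(x) = … = f_n(x) = 0, g_1(x) ≠ 0, …, g_n(x) ≠ 0 has a solution in R_p^m if and only if it has a solution in (𝔽̄_p^ℕ)^m. -/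
noncomputable section

/-- `ℤ[ζ_{∞'}]`: the subring of a fixed algebraic closure of `ℚ` generated by all roots of
unity of order coprime to `p`. -/
noncomputable def Zcop (p : ℕ) : Subring (AlgebraicClosure ℚ) :=
  Subring.closure {x : AlgebraicClosure ℚ | ∃ n : ℕ, 0 < n ∧ Nat.Coprime n p ∧ x ^ n = 1}

/-- `R_p = ℤ[ζ_{∞'}] / p ℤ[ζ_{∞'}]`. -/
noncomputable abbrev Rp (p : ℕ) : Type :=
  Zcop p ⧸ Ideal.span {(p : Zcop p)}


theorem aux_totient (n : ℕ) : n ≤ 2 * n.totient ^ 2 ∧ (Odd n → n ≤ n.totient ^ 2) := by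
  induction n using Nat.recOnPosPrimePosCoprime with
  | prime_pow q k hq hk =>
    rw [Nat.totient_prime_pow hq hk]
    obtain ⟨k, rfl⟩ : ∃ j, k = j + 1 := ⟨k - 1, by omega⟩
    obtain ⟨r, rfl⟩ : ∃ r, q = r + 1 := ⟨q - 1, by have := hq.pos; omega⟩
    have hr : 1 ≤ r := by have := hq.two_le; omega
    simp only [Nat.add_sub_cancel]
    have h1 : 1 ≤ (r + 1) ^ k := Nat.one_le_pow _ _ (by omega)
    rw [pow_succ (r+1) k]
    set t := (r + 1) ^ k with ht
    rcases Nat.lt_or_ge r 2 with h | h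
    · have : r = 1 := by omega
      subst this
      refine ⟨by nlinarith, fun ho => ?_⟩
      exfalso
      have : Even (t * (1 + 1)) := ⟨t, by ring⟩
      exact (Nat.not_even_iff_odd.2 ho) this
    · have h2 : r + 1 ≤ r ^ 2 := by nlinarith
      have h3 : t ≤ t ^ 2 := by nlinarith
      have : t * (r + 1) ≤ (t * r) ^ 2 := by
        rw [mul_pow]; exact Nat.mul_le_mul h3 h2
      exact ⟨by omega, fun _ => this⟩
  | zero => simp
  | one => simp
  | coprime a b ha hb hab iha ihb =>
    rw [Nat.totient_mul hab]
    refine ⟨?_, fun ho => ?_⟩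
    · rcases Nat.even_or_odd a with h | h
      · have hbo : Odd b := by
          rw [← Nat.not_even_iff_odd]
          intro h'
          have := Nat.dvd_gcd h.two_dvd h'.two_dvd
          rw [hab.gcd_eq_one] at this
          omega
        calc a * b ≤ (2 * a.totient ^ 2) * b.totient ^ 2 := Nat.mul_le_mul iha.1 (ihb.2 hbo)
          _ = _ := by ring
      · calc a * b ≤ (a.totient ^ 2) * (2 * b.totient ^ 2) := Nat.mul_le_mul (iha.2 h) ihb.1
          _ = _ := by ring
    · rw [Nat.odd_mul] at ho
      calc a * b ≤ (a.totient ^ 2) * (b.totient ^ 2) := Nat.mul_le_mul (iha.2 ho.1) (ihb.2 ho.2)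
          _ = _ := by ring

theorem aux_growth (p : ℕ) (hp : p.Prime) (n M0 : ℕ) (h0 : 0 < M0) :
    ∃ M, 0 < M ∧ M0 ∣ M ∧ M * n ≤ (p ^ M - 1).totient := by
  have h1 : Filter.Tendsto (fun k : ℕ => (k : ℝ) ^ 2 / 2 ^ k) Filter.atTop (nhds 0) :=
    tendsto_pow_const_div_const_pow_of_one_lt 2 (by norm_num)
  have h2 : ∀ᶠ k : ℕ in Filter.atTop, (k : ℝ) ^ 2 / 2 ^ k < 1 / (2 * n ^ 2 + 1 + 1) :=
    h1.eventually_lt_const (by positivity)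
  obtain ⟨K, hK⟩ := Filter.eventually_atTop.1 h2
  refine ⟨M0 * (K + 1), by positivity, ⟨_, rfl⟩, ?_⟩
  set M := M0 * (K + 1) with hM
  have hMK : K ≤ M := by nlinarith
  have hMpos : 1 ≤ M := by rw [hM]; exact Nat.mul_pos h0 (by omega)
  have h3 := hK M hMK
  rw [div_lt_div_iff₀ (by positivity) (by positivity)] at h3
  have h4 : M ^ 2 * (2 * n ^ 2 + 1 + 1) < 2 ^ M := by
    rw [one_mul] at h3; exact_mod_cast h3
  have h5 : 2 ^ M ≤ p ^ M := Nat.pow_le_pow_left hp.two_le _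
  by_contra hlt
  push Not at hlt
  have h6 := (aux_totient (p ^ M - 1)).1
  have h7 : (p ^ M - 1).totient ^ 2 ≤ (M * n) ^ 2 := Nat.pow_le_pow_left hlt.le 2
  have h8 : p ^ M - 1 ≤ 2 * (M * n) ^ 2 := by omega
  have h9 : p ^ M ≤ 2 * (M * n) ^ 2 + 1 := by omega
  nlinarith

section
variable {p : ℕ} [hp : Fact p.Prime]

theorem aux_exists_hom (A : Type*) [CommRing A] [Algebra (ZMod p) A]
    [Algebra.IsIntegral (ZMod p) A] (P : Ideal A) [hP : P.IsPrime] :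
    ∃ φ : A →ₐ[ZMod p] AlgebraicClosure (ZMod p), RingHom.ker φ = P := by
  have : Algebra.IsIntegral (ZMod p) (A ⧸ P) := inferInstance
  have hf : IsField (A ⧸ P) := isField_of_isIntegral_of_isField' (Field.toIsField (ZMod p))
  have hmax : P.IsMaximal := Ideal.Quotient.maximal_of_isField P hf
  let φ : A →ₐ[ZMod p] AlgebraicClosure (ZMod p) :=
    (IsAlgClosed.lift (R := ZMod p) (S := A ⧸ P)).comp (Ideal.Quotient.mkₐ (ZMod p) P)
  refine ⟨φ, (hmax.eq_of_le (RingHom.ker_ne_top _) ?_).symm⟩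
  intro x hx
  rw [RingHom.mem_ker]
  have : Ideal.Quotient.mk P x = 0 := Ideal.Quotient.eq_zero_iff_mem.2 hx
  simp [φ, this]

theorem aux_integral (A : Type*) [CommRing A] [Algebra (ZMod p) A]
    (h : ∀ x : A, ∃ k, 0 < k ∧ x ^ p ^ k = x) : Algebra.IsIntegral (ZMod p) A := by
  refine ⟨fun x => ?_⟩
  obtain ⟨k, hk, hx⟩ := h x
  have h1 : 1 < p ^ k := Nat.one_lt_pow hk.ne' hp.out.one_lt
  refine ⟨Polynomial.X ^ p ^ k - Polynomial.X, ?_, by simp [hx]⟩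
  refine Polynomial.monic_X_pow_sub ?_
  rw [Polynomial.degree_X]; exact_mod_cast h1

theorem aux_reduced (A : Type*) [CommRing A] 
    (h : ∀ x : A, ∃ k, 0 < k ∧ x ^ p ^ k = x) : IsReduced A := by
  refine (isReduced_iff_pow_one_lt 2 (by norm_num)).2 fun x hx2 => ?_
  obtain ⟨k, hk, hx⟩ := h x
  have h1 : 1 < p ^ k := Nat.one_lt_pow hk.ne' hp.out.one_lt
  rw [← hx]
  exact pow_eq_zero_of_le h1 hx2

theorem aux_iter {A : Type*} [CommRing A] {k : ℕ} (x : A) (hx : x ^ p ^ k = x) (j : ℕ) :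
    x ^ p ^ (k * j) = x := by
  induction j with
  | zero => simp
  | succ j ih => rw [mul_add, pow_add, pow_mul, ih, mul_one, hx]

theorem aux_map {A B : Type*} [CommRing A] [CommRing B] [Algebra ℤ A] [Algebra ℤ B] {m : ℕ} (φ : A →+* B) (x : Fin m → A)
    (f : MvPolynomial (Fin m) ℤ) :
    φ (MvPolynomial.aeval x f) = MvPolynomial.aeval (fun i => φ (x i)) f := by
  have e : φ.comp (algebraMap ℤ A) = algebraMap ℤ B := RingHom.ext_int _ _
  rw [MvPolynomial.map_aeval, e]
  rfl

/-- forward direction -/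
theorem aux_forward (A : Type*) [CommRing A] [Algebra ℤ A] [Algebra (ZMod p) A]
    (h : ∀ x : A, ∃ k, 0 < k ∧ x ^ p ^ k = x) (m n : ℕ)
    (f g : Fin n → MvPolynomial (Fin m) ℤ)
    (hx : ∃ x : Fin m → A, ∀ i : Fin n,
        MvPolynomial.aeval x (f i) = 0 ∧ MvPolynomial.aeval x (g i) ≠ 0) :
    (∃ x : Fin m → (ℕ → AlgebraicClosure (ZMod p)), ∀ i : Fin n,
        MvPolynomial.aeval x (f i) = 0 ∧ MvPolynomial.aeval x (g i) ≠ 0) := by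
  obtain ⟨x, hx⟩ := hx
  have := aux_integral A h
  have := aux_reduced A h
  have key : ∀ i : Fin n, ∃ φ : A →ₐ[ZMod p] AlgebraicClosure (ZMod p),
      φ (MvPolynomial.aeval x (g i)) ≠ 0 := by
    intro i
    have h1 : MvPolynomial.aeval x (g i) ∉ nilradical A := by
      rw [nilradical_eq_zero]; exact (hx i).2
    rw [nilradical_eq_sInf, Submodule.mem_sInf] at h1
    push Not at h1
    obtain ⟨P, hP, hP2⟩ := h1
    have : Ideal.IsPrime P := hP
    obtain ⟨φ, hφ⟩ := aux_exists_hom (p := p) A P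
    exact ⟨φ, fun h0 => hP2 (hφ ▸ h0)⟩
  choose φ hφ using key
  rcases Nat.eq_zero_or_pos n with rfl | hn
  · exact ⟨0, fun i => i.elim0⟩
  let Φ : A →+* (ℕ → AlgebraicClosure (ZMod p)) :=
    RingHom.pi fun k => ((φ ⟨k % n, Nat.mod_lt _ hn⟩ : A →ₐ[ZMod p] _) : A →+* _)
  refine ⟨fun i => Φ (x i), fun i => ?_⟩
  rw [← aux_map, ← aux_map, (hx i).1, map_zero]
  refine ⟨rfl, fun h0 => hφ i ?_⟩
  have := congrFun h0 i
  simp only [Φ, RingHom.pi_apply, Nat.mod_eq_of_lt i.2] at this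
  exact this


theorem aux_root (S : Type*) [CommRing S] [Algebra (ZMod p) S] {N : ℕ} (hN : N.Coprime p)
    (z : S) (hz : Polynomial.aeval z (Polynomial.cyclotomic N (ZMod p)) = 0)
    (ψ : S →ₐ[ZMod p] AlgebraicClosure (ZMod p)) : IsPrimitiveRoot (ψ z) N := by
  have : NeZero (N : AlgebraicClosure (ZMod p)) := by
    refine ⟨fun h => ?_⟩
    rw [CharP.cast_eq_zero_iff _ p] at h
    have := Nat.dvd_gcd h dvd_rfl
    rw [hN.gcd_eq_one] at this
    exact hp.out.one_lt.ne' (Nat.dvd_one.1 this)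
  rw [← Polynomial.isRoot_cyclotomic_iff, ← Polynomial.map_cyclotomic N
    (algebraMap (ZMod p) (AlgebraicClosure (ZMod p))), Polynomial.IsRoot.def,
    Polynomial.eval_map_algebraMap, Polynomial.aeval_algHom_apply, hz, map_zero]

theorem aux_card (S : Type*) [CommRing S] [Algebra (ZMod p) S] [Module.Finite (ZMod p) S]
    {M N n : ℕ} (hM : 0 < M) (hS : ∀ x : S, x ^ p ^ M = x) (z : S)
    (α : AlgebraicClosure (ZMod p)) (hα : IsPrimitiveRoot α N)
    (hψ : ∀ a, N.Coprime a → ∃ ψ : S →ₐ[ZMod p] AlgebraicClosure (ZMod p), ψ z = α ^ a)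
    (hn : M * n ≤ N.totient) : n ≤ Nat.card (MaximalSpectrum S) := by
  classical
  have : IsArtinianRing S := IsArtinianRing.of_finite (ZMod p) S
  have : Fintype (MaximalSpectrum S) := Fintype.ofFinite _
  have : Nonempty (S →ₐ[ZMod p] AlgebraicClosure (ZMod p)) :=
    ⟨(hψ 1 (Nat.coprime_one_right N)).choose⟩
  choose! ψ hψ using hψ
  have hint : Algebra.IsIntegral (ZMod p) S := inferInstance
  have hmax : ∀ a, (RingHom.ker (ψ a)).IsMaximal := by
    intro a
    have hpr : (RingHom.ker (ψ a)).IsPrime := RingHom.ker_isPrime _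
    exact Ideal.Quotient.maximal_of_isField _
      (isField_of_isIntegral_of_isField' (Field.toIsField (ZMod p)))
  let F : ℕ → MaximalSpectrum S := fun a => ⟨RingHom.ker (ψ a), hmax a⟩
  have h1 := Finset.card_le_mul_card_image (f := F) {a ∈ Finset.range N | N.Coprime a} M ?_
  · rw [← Nat.totient_eq_card_coprime] at h1
    rw [Nat.card_eq_fintype_card]
    have h2 := hn.trans h1
    exact (Nat.le_of_mul_le_mul_left h2 hM).trans (Finset.card_le_univ _)
  · intro I _
    have hI := I.isMaximal
    let _ : Field (S ⧸ I.asIdeal) := Ideal.Quotient.field _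
    have : Finite S := Module.finite_of_finite (ZMod p)
    have : Finite (S ⧸ I.asIdeal) := Finite.of_surjective _ Ideal.Quotient.mk_surjective
    have : Fintype (S ⧸ I.asIdeal) := Fintype.ofFinite _
    have hcard : Fintype.card (S ⧸ I.asIdeal) ≤ p ^ M := by
      have h1 : 1 < p ^ M := Nat.one_lt_pow hM.ne' hp.out.one_lt
      have hne := FiniteField.X_pow_card_sub_X_ne_zero (S ⧸ I.asIdeal) h1
      have hd := FiniteField.X_pow_card_sub_X_natDegree_eq (S ⧸ I.asIdeal) h1
      rw [← hd, ← Finset.card_univ]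
      refine Polynomial.card_le_degree_of_subset_roots (fun x _ => ?_)
      rw [Polynomial.mem_roots hne]
      obtain ⟨x, rfl⟩ := Ideal.Quotient.mk_surjective x
      simp [← map_pow, hS]
    have hrank : Module.finrank (ZMod p) (S ⧸ I.asIdeal) ≤ M := by
      rw [Module.card_eq_pow_finrank (K := ZMod p), ZMod.card] at hcard
      exact (Nat.pow_le_pow_iff_right hp.out.one_lt).1 hcard
    have hcardhom := card_algHom_le_finrank (ZMod p) (S ⧸ I.asIdeal) (AlgebraicClosure (ZMod p))
    refine le_trans ?_ (hcardhom.trans hrank)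
    have : Finite ((S ⧸ I.asIdeal) →ₐ[ZMod p] AlgebraicClosure (ZMod p)) := inferInstance
    rw [← Fintype.card_coe, ← Nat.card_eq_fintype_card]
    have hk : ∀ a : {a // a ∈ {a ∈ {a ∈ Finset.range N | N.Coprime a} | F a = I}},
        ∀ s ∈ I.asIdeal, ψ a.1 s = 0 := by
      rintro ⟨a, ha⟩ s hs
      have hFa : F a = I := (Finset.mem_filter.1 ha).2
      rw [← hFa] at hs
      exact hs
    refine Nat.card_le_card_of_injective
      (fun a => Ideal.Quotient.liftₐ I.asIdeal (ψ a.1) (hk a)) ?_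
    rintro ⟨a, ha⟩ ⟨b, hb⟩ hab
    have h2 := DFunLike.congr_fun hab (Ideal.Quotient.mk I.asIdeal z)
    simp only [Finset.mem_filter, Finset.mem_range] at ha hb
    have h3 : ψ a z = ψ b z := h2
    rw [hψ a ha.1.2, hψ b hb.1.2] at h3
    exact Subtype.ext (hα.pow_inj ha.1.1 hb.1.1 h3)

theorem aux_solve (S : Type*) [CommRing S] [Algebra ℤ S] [Algebra (ZMod p) S]
    [Module.Finite (ZMod p) S]
    {M n m : ℕ} (hM : 0 < M) (hS : ∀ x : S, x ^ p ^ M = x) (z : S)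
    (hz : Polynomial.aeval z (Polynomial.cyclotomic (p ^ M - 1) (ZMod p)) = 0)
    (hn : n ≤ Nat.card (MaximalSpectrum S)) (hn0 : 0 < n)
    (f g : Fin n → MvPolynomial (Fin m) ℤ)
    (x : Fin n → Fin m → AlgebraicClosure (ZMod p))
    (hx : ∀ i j, (x i j) ^ p ^ M = x i j)
    (hf : ∀ i k, MvPolynomial.aeval (x k) (f i) = 0)
    (hg : ∀ i, MvPolynomial.aeval (x i) (g i) ≠ 0) :
    ∃ y : Fin m → S, ∀ i, MvPolynomial.aeval y (f i) = 0 ∧ MvPolynomial.aeval y (g i) ≠ 0 := by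
  classical
  have : IsArtinianRing S := IsArtinianRing.of_finite (ZMod p) S
  have : Fintype (MaximalSpectrum S) := Fintype.ofFinite _
  have : IsReduced S := aux_reduced (p := p) S fun x => ⟨M, hM, hS x⟩
  have hN : (p ^ M - 1).Coprime p := by
    have h1 : 1 ≤ p ^ M := Nat.one_le_pow _ _ hp.out.pos
    have h2 : (p ^ M - 1).Coprime (p ^ M) := by
      rw [Nat.coprime_self_sub_left h1]; simp
    exact Nat.Coprime.coprime_dvd_right (dvd_pow_self p hM.ne') h2
  have h1 : 1 < p ^ M := Nat.one_lt_pow hM.ne' hp.out.one_lt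
  have : NeZero (p ^ M - 1) := ⟨by omega⟩
  -- homs
  have hex : ∀ I : MaximalSpectrum S, ∃ φ : S →ₐ[ZMod p] AlgebraicClosure (ZMod p),
      RingHom.ker φ = I.asIdeal := fun I => by
    have := I.isMaximal.isPrime
    exact aux_exists_hom S I.asIdeal
  choose φ hφ using hex
  -- surjection
  obtain ⟨σ, hσ⟩ : ∃ σ : MaximalSpectrum S → Fin n, Function.Surjective σ := by
    rw [Nat.card_eq_fintype_card] at hn
    have : Nonempty (Fin n) := ⟨⟨0, hn0⟩⟩
    obtain ⟨e⟩ := Function.Embedding.nonempty_of_card_le (α := Fin n) (β := MaximalSpectrum S)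
      (by simpa using hn)
    exact ⟨Function.invFun e, Function.invFun_surjective e.injective⟩
  -- lifts
  have hlift : ∀ (I : MaximalSpectrum S) (c : AlgebraicClosure (ZMod p)), c ^ p ^ M = c →
      ∃ s : S, φ I s = c := by
    intro I c hc
    by_cases h0 : c = 0
    · exact ⟨0, by rw [map_zero, h0]⟩
    have hc1 : c ^ (p ^ M - 1) = 1 := by
      have : c * c ^ (p ^ M - 1) = c * 1 := by
        rw [← pow_succ', Nat.sub_add_cancel h1.le, hc, mul_one]
      exact mul_left_cancel₀ h0 this
    obtain ⟨i, -, hi⟩ := (aux_root S hN z hz (φ I)).eq_pow_of_pow_eq_one hc1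
    exact ⟨z ^ i, by rw [map_pow, hi]⟩
  choose s hs using fun (I : MaximalSpectrum S) (j : Fin m) => hlift I (x (σ I) j) (hx _ _)
  let y : Fin m → S := fun j => (IsArtinianRing.equivPi S).symm
    (fun I => Ideal.Quotient.mk I.asIdeal (s I j))
  have hy : ∀ I j, φ I (y j) = x (σ I) j := by
    intro I j
    rw [← hs I j, ← sub_eq_zero, ← map_sub]
    change y j - s I j ∈ RingHom.ker (φ I)
    rw [hφ, ← Ideal.Quotient.eq]
    have := congrFun ((IsArtinianRing.equivPi S).apply_symm_apply
      (fun I => Ideal.Quotient.mk I.asIdeal (s I j))) I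
    exact this
  have hev : ∀ I (q : MvPolynomial (Fin m) ℤ), φ I (MvPolynomial.aeval y q) =
      MvPolynomial.aeval (x (σ I)) q := by
    intro I q
    have := aux_map (φ I : S →+* AlgebraicClosure (ZMod p)) y q
    simp only [RingHom.coe_coe, hy] at this
    exact this
  refine ⟨y, fun i => ⟨?_, fun h0 => ?_⟩⟩
  · apply (IsArtinianRing.equivPi S).injective
    funext I
    rw [map_zero, IsArtinianRing.equivPi_apply]
    refine Ideal.Quotient.eq_zero_iff_mem.2 ?_
    rw [← hφ, RingHom.mem_ker, hev, hf]
  · obtain ⟨I, rfl⟩ := hσ i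
    apply hg (σ I)
    rw [← hev, h0, map_zero]


theorem aux_closure (c : AlgebraicClosure (ZMod p)) : ∃ k, 0 < k ∧ c ^ p ^ k = c := by
  have hc : IsIntegral (ZMod p) c := Algebra.IsIntegral.isIntegral c
  let K := IntermediateField.adjoin (ZMod p) {c}
  have : FiniteDimensional (ZMod p) K := IntermediateField.adjoin.finiteDimensional hc
  have : Finite K := Module.finite_of_finite (ZMod p)
  have : Fintype K := Fintype.ofFinite _
  refine ⟨Module.finrank (ZMod p) K, Module.finrank_pos, ?_⟩
  have h := FiniteField.pow_card (⟨c, IntermediateField.mem_adjoin_simple_self _ c⟩ : K)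
  rw [Module.card_eq_pow_finrank (K := ZMod p), ZMod.card] at h
  exact congrArg Subtype.val h

theorem aux_backward (A : Type*) [CommRing A] [Algebra ℤ A] [Algebra (ZMod p) A]
    (hA : ∀ N : ℕ, 0 < N → N.Coprime p → ∃ (z : A) (α : AlgebraicClosure (ZMod p)),
      IsPrimitiveRoot α N ∧ Polynomial.aeval z (Polynomial.cyclotomic N (ZMod p)) = 0 ∧
      ∀ a, N.Coprime a → ∃ ψ : A →ₐ[ZMod p] AlgebraicClosure (ZMod p), ψ z = α ^ a) (m n : ℕ)
    (f g : Fin n → MvPolynomial (Fin m) ℤ)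
    (hx : ∃ x : Fin m → (ℕ → AlgebraicClosure (ZMod p)), ∀ i : Fin n,
        MvPolynomial.aeval x (f i) = 0 ∧ MvPolynomial.aeval x (g i) ≠ 0) :
    ∃ x : Fin m → A, ∀ i : Fin n,
        MvPolynomial.aeval x (f i) = 0 ∧ MvPolynomial.aeval x (g i) ≠ 0 := by
  classical
  rcases Nat.eq_zero_or_pos n with rfl | hn
  · exact ⟨0, fun i => i.elim0⟩
  obtain ⟨x, hx⟩ := hx
  have hev : ∀ (k : ℕ) (q : MvPolynomial (Fin m) ℤ),
      MvPolynomial.aeval x q k = MvPolynomial.aeval (fun j => x j k) q := fun k q =>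
    aux_map (Pi.evalRingHom (fun _ : ℕ => AlgebraicClosure (ZMod p)) k) x q
  have hk : ∀ i : Fin n, ∃ k, MvPolynomial.aeval (fun j => x j k) (g i) ≠ 0 := by
    intro i
    by_contra! hcon
    refine (hx i).2 (funext fun k => ?_)
    rw [hev, hcon]; rfl
  choose k hk using hk
  choose e he0 he using fun (i : Fin n) (j : Fin m) => aux_closure (x j (k i))
  obtain ⟨M, hM, hdvd, hMn⟩ := aux_growth p hp.out n (∏ i, ∏ j, e i j)
    (Finset.prod_pos fun i _ => Finset.prod_pos fun j _ => he0 i j)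
  have h1 : 1 < p ^ M := Nat.one_lt_pow hM.ne' hp.out.one_lt
  have hN : (p ^ M - 1).Coprime p := by
    have h2 : (p ^ M - 1).Coprime (p ^ M) := by
      rw [Nat.coprime_self_sub_left h1.le]; simp
    exact Nat.Coprime.coprime_dvd_right (dvd_pow_self p hM.ne') h2
  obtain ⟨z, α, hα, hz, hψ⟩ := hA (p ^ M - 1) (by omega) hN
  have hnt : Nontrivial A :=
    ((hψ 1 (Nat.coprime_one_right _)).choose : A →+* AlgebraicClosure (ZMod p)).domain_nontrivial
  have : CharP A p := charP_of_injective_algebraMap (algebraMap (ZMod p) A).injective p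
  have hzN : z ^ (p ^ M - 1) = 1 := by
    obtain ⟨r, hr⟩ := Polynomial.cyclotomic.dvd_X_pow_sub_one (p ^ M - 1) (ZMod p)
    have := congrArg (Polynomial.aeval z) hr
    rw [map_mul, hz, zero_mul] at this
    simpa [sub_eq_zero] using this
  have hzM : z ^ p ^ M = z := by
    conv_lhs => rw [← Nat.sub_add_cancel h1.le]
    rw [pow_succ, hzN, one_mul]
  let S := Algebra.adjoin (ZMod p) {z}
  have hint : IsIntegral (ZMod p) z := by
    refine ⟨Polynomial.cyclotomic (p ^ M - 1) (ZMod p), Polynomial.cyclotomic.monic _ _, hz⟩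
  have : Module.Finite (ZMod p) S := Algebra.finite_adjoin_simple_of_isIntegral hint
  have hS' : ∀ s ∈ Algebra.adjoin (ZMod p) {z}, s ^ p ^ M = s := by
    intro s hs
    induction hs using Algebra.adjoin_induction with
    | mem s hs => rw [Set.mem_singleton_iff.1 hs, hzM]
    | algebraMap r => rw [← map_pow, ZMod.pow_card_pow]
    | add a b _ _ ha hb => rw [add_pow_char_pow, ha, hb]
    | mul a b _ _ ha hb => rw [mul_pow, ha, hb]
  have hS : ∀ s : S, s ^ p ^ M = s := fun s => Subtype.ext (hS' s.1 s.2)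
  let zS : S := ⟨z, Algebra.self_mem_adjoin_singleton _ z⟩
  have hzS : Polynomial.aeval zS (Polynomial.cyclotomic (p ^ M - 1) (ZMod p)) = 0 := by
    apply Subtype.ext
    have := Polynomial.aeval_algHom_apply S.val zS (Polynomial.cyclotomic (p ^ M - 1) (ZMod p))
    exact this.symm.trans hz
  have hcard : n ≤ Nat.card (MaximalSpectrum S) := by
    refine aux_card S hM hS zS α hα (fun a ha => ?_) hMn
    obtain ⟨ψ, h⟩ := hψ a ha
    exact ⟨ψ.comp S.val, h⟩
  obtain ⟨y, hy⟩ := aux_solve S hM hS zS hzS hcard hn f g (fun i j => x j (k i))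
    (fun i j => by
      obtain ⟨t, ht⟩ : e i j ∣ M :=
        (Finset.dvd_prod_of_mem (e i) (Finset.mem_univ j)).trans
          ((Finset.dvd_prod_of_mem (fun i => ∏ j, e i j) (Finset.mem_univ i)).trans hdvd)
      rw [ht]
      exact aux_iter _ (he i j) t)
    (fun i l => by rw [← hev, (hx i).1]; rfl) hk
  refine ⟨fun j => (y j : A), fun i => ?_⟩
  have hm := fun q => aux_map (S.val : S →+* A) y q
  simp only [RingHom.coe_coe, Subalgebra.coe_val] at hm
  rw [← hm, ← hm, (hy i).1]
  exact ⟨rfl, fun h0 => (hy i).2 (Subtype.ext h0)⟩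

end

theorem Zcop_integral (p : ℕ) (x : AlgebraicClosure ℚ) (hx : x ∈ Zcop p) : IsIntegral ℤ x := by
  have h : Zcop p ≤ (integralClosure ℤ (AlgebraicClosure ℚ)).toSubring := by
    refine Subring.closure_le.2 ?_
    rintro y ⟨n, hn, -, hy⟩
    exact IsIntegral.of_pow hn (by rw [hy]; exact isIntegral_one)
  exact h hx

theorem Rp_nontrivial (p : ℕ) [hp : Fact p.Prime] : Nontrivial (Rp p) := by
  refine Ideal.Quotient.nontrivial_iff.2 fun h => ?_
  rw [Ideal.span_singleton_eq_top] at h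
  obtain ⟨u, hu⟩ := h.exists_right_inv
  have hu' : (p : AlgebraicClosure ℚ) * (u : AlgebraicClosure ℚ) = 1 := by
    simpa using congrArg (Subtype.val) hu
  have hp0 : (p : AlgebraicClosure ℚ) ≠ 0 := by exact_mod_cast hp.out.ne_zero
  have h1 : (u : AlgebraicClosure ℚ) = algebraMap ℚ (AlgebraicClosure ℚ) ((p : ℚ)⁻¹) := by
    rw [map_inv₀, map_natCast]; exact eq_inv_of_mul_eq_one_right hu'
  have h2 := Zcop_integral p _ u.2
  rw [h1, isIntegral_algebraMap_iff (algebraMap ℚ (AlgebraicClosure ℚ)).injective] at h2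
  obtain ⟨a, ha⟩ := IsIntegrallyClosed.isIntegral_iff.1 h2
  have h3 : (p : ℚ) * a = 1 := by
    have : (a : ℚ) = (p : ℚ)⁻¹ := ha
    rw [this]
    exact mul_inv_cancel₀ (by exact_mod_cast hp.out.ne_zero)
  have h4 : (p : ℤ) * a = 1 := by exact_mod_cast h3
  have h5 : (p : ℤ) ∣ 1 := ⟨a, h4.symm⟩
  have h6 : p ∣ 1 := by exact_mod_cast h5
  exact hp.out.one_lt.ne' (Nat.dvd_one.1 h6)

theorem Rp_charP (p : ℕ) [hp : Fact p.Prime] : CharP (Rp p) p := by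
  have := Rp_nontrivial p
  rw [CharP.charP_iff_prime_eq_zero hp.out]
  have : Ideal.Quotient.mk (Ideal.span {(p : Zcop p)}) (p : Zcop p) = 0 :=
    Ideal.Quotient.eq_zero_iff_mem.2 (Ideal.mem_span_singleton_self _)
  simpa using this

theorem Rp_frob (p : ℕ) [hp : Fact p.Prime] (x : Rp p) : ∃ k, 0 < k ∧ x ^ p ^ k = x := by
  have := Rp_charP p
  obtain ⟨⟨x, hx⟩, rfl⟩ := Ideal.Quotient.mk_surjective x
  unfold Zcop at hx
  induction hx using Subring.closure_induction with
  | mem x hx =>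
    obtain ⟨n, hn, hnp, hxn⟩ := hx
    refine ⟨n.totient, Nat.totient_pos.2 hn, ?_⟩
    rw [← map_pow]
    congr 1
    apply Subtype.ext
    change x ^ p ^ n.totient = x
    have h1 := Nat.ModEq.pow_totient hnp.symm
    obtain ⟨c, hc⟩ := (Nat.modEq_iff_dvd' (Nat.one_le_pow _ _ hp.out.pos)).1 h1.symm
    have h2 : p ^ n.totient = n * c + 1 := by
      have := Nat.one_le_pow n.totient p hp.out.pos
      omega
    rw [h2, pow_succ, pow_mul, hxn, one_pow, one_mul]
  | zero =>
    exact ⟨1, one_pos, (map_zero (Ideal.Quotient.mk (Ideal.span {(p : Zcop p)}))).symm ▸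
      zero_pow (pow_ne_zero _ hp.out.ne_zero)⟩
  | one =>
    exact ⟨1, one_pos, (map_one (Ideal.Quotient.mk (Ideal.span {(p : Zcop p)}))).symm ▸
      one_pow _⟩
  | add x y hx hy ihx ihy =>
    obtain ⟨a, ha, hxa⟩ := ihx
    obtain ⟨b, hb, hyb⟩ := ihy
    refine ⟨a * b, Nat.mul_pos ha hb, ?_⟩
    have e := map_add (Ideal.Quotient.mk (Ideal.span {(p : Zcop p)})) ⟨x, hx⟩ ⟨y, hy⟩
    have h1 := aux_iter _ hxa b
    have h2 := aux_iter _ hyb a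
    rw [mul_comm b a] at h2
    have h3 := add_pow_char_pow (R := Rp p) (Ideal.Quotient.mk _ ⟨x, hx⟩)
      (Ideal.Quotient.mk _ ⟨y, hy⟩) p (a * b)
    rw [h1, h2, ← e] at h3
    exact h3
  | neg x hx ih =>
    obtain ⟨a, ha, hxa⟩ := ih
    refine ⟨a, ha, ?_⟩
    have e := map_neg (Ideal.Quotient.mk (Ideal.span {(p : Zcop p)})) ⟨x, hx⟩
    have h3 := map_neg (iterateFrobenius (Rp p) p a) (Ideal.Quotient.mk _ ⟨x, hx⟩)
    rw [iterateFrobenius_def, iterateFrobenius_def, hxa, ← e] at h3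
    exact h3
  | mul x y hx hy ihx ihy =>
    obtain ⟨a, ha, hxa⟩ := ihx
    obtain ⟨b, hb, hyb⟩ := ihy
    refine ⟨a * b, Nat.mul_pos ha hb, ?_⟩
    have e := map_mul (Ideal.Quotient.mk (Ideal.span {(p : Zcop p)})) ⟨x, hx⟩ ⟨y, hy⟩
    have h1 := aux_iter _ hxa b
    have h2 := aux_iter _ hyb a
    rw [mul_comm b a] at h2
    have h3 := mul_pow (M := Rp p) (Ideal.Quotient.mk _ ⟨x, hx⟩)
      (Ideal.Quotient.mk _ ⟨y, hy⟩) (p ^ (a * b))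
    rw [h1, h2, ← e] at h3
    exact h3

theorem Rp_homs (p : ℕ) [hp : Fact p.Prime] [Algebra (ZMod p) (Rp p)] (N : ℕ) (hN0 : 0 < N)
    (hN : N.Coprime p) : ∃ (z : Rp p) (α : AlgebraicClosure (ZMod p)),
      IsPrimitiveRoot α N ∧ Polynomial.aeval z (Polynomial.cyclotomic N (ZMod p)) = 0 ∧
      ∀ a, N.Coprime a → ∃ ψ : Rp p →ₐ[ZMod p] AlgebraicClosure (ZMod p), ψ z = α ^ a := by
  have := Rp_nontrivial p
  have := Rp_charP p
  have : Algebra.IsIntegral (ZMod p) (Rp p) := aux_integral (Rp p) (Rp_frob p)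
  have : NeZero (N : AlgebraicClosure ℚ) := ⟨by exact_mod_cast hN0.ne'⟩
  obtain ⟨ζ, hζ⟩ := HasEnoughRootsOfUnity.exists_primitiveRoot (AlgebraicClosure ℚ) N
  have hmem : ζ ∈ Zcop p := Subring.subset_closure ⟨N, hN0, hN, hζ.pow_eq_one⟩
  let π : Zcop p →+* Rp p := Ideal.Quotient.mk (Ideal.span {(p : Zcop p)})
  let zZ : Zcop p := ⟨ζ, hmem⟩
  have hcyc : (Polynomial.cyclotomic N ℤ).eval₂ (Int.castRingHom (Zcop p)) zZ = 0 := by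
    apply Subtype.ext
    have h1 := Polynomial.hom_eval₂ (Polynomial.cyclotomic N ℤ) (Int.castRingHom (Zcop p))
      (Zcop p).subtype zZ
    have h2 : ((Zcop p).subtype.comp (Int.castRingHom (Zcop p))) =
      Int.castRingHom (AlgebraicClosure ℚ) := RingHom.ext_int _ _
    rw [h2] at h1
    refine h1.trans ?_
    rw [← Polynomial.eval_map, Polynomial.map_cyclotomic]
    exact hζ.isRoot_cyclotomic hN0
  have hz : Polynomial.aeval (π zZ) (Polynomial.cyclotomic N (ZMod p)) = 0 := by
    rw [← Polynomial.map_cyclotomic N (Int.castRingHom (ZMod p)), Polynomial.aeval_def,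
      Polynomial.eval₂_map]
    have h2 : (algebraMap (ZMod p) (Rp p)).comp (Int.castRingHom (ZMod p)) =
      π.comp (Int.castRingHom (Zcop p)) := RingHom.ext_int _ _
    rw [h2, ← Polynomial.hom_eval₂, hcyc, map_zero]
  obtain ⟨P, hP⟩ := Ideal.exists_maximal (Rp p)
  have := hP.isPrime
  obtain ⟨φ, -⟩ := aux_exists_hom (p := p) (Rp p) P
  refine ⟨π zZ, φ (π zZ), aux_root (Rp p) hN _ hz φ, hz, fun a ha => ?_⟩
  have hconj : IsConjRoot ℚ (ζ ^ a) ζ := by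
    have h1 := Polynomial.cyclotomic_eq_minpoly_rat hζ hN0
    have h2 := Polynomial.cyclotomic_eq_minpoly_rat (hζ.pow_of_coprime a ha.symm) hN0
    exact h2.symm.trans h1
  have : IsAlgClosure ℚ (AlgebraicClosure ℚ) := by
    convert AlgebraicClosure.instIsAlgClosure ℚ
    · rfl
    · exact Subsingleton.elim _ _
  have : Normal ℚ (AlgebraicClosure ℚ) := IsAlgClosure.normal ℚ _
  obtain ⟨σ, hσ⟩ := isConjRoot_iff_exists_algEquiv.1 hconj
  have hle : Zcop p ≤ (Zcop p).comap (σ : AlgebraicClosure ℚ →+* AlgebraicClosure ℚ) := by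
    refine Subring.closure_le.2 ?_
    rintro y ⟨n, hn, hnp, hy⟩
    refine Subring.subset_closure ⟨n, hn, hnp, ?_⟩
    change (σ y) ^ n = 1
    rw [← map_pow, hy, map_one]
  let τ : Zcop p →+* Zcop p :=
    (σ : AlgebraicClosure ℚ →+* AlgebraicClosure ℚ).restrict (Zcop p) (Zcop p) hle
  have hτ : τ zZ = zZ ^ a := Subtype.ext hσ
  let ψ0 : Zcop p →+* AlgebraicClosure (ZMod p) := (φ : Rp p →+* _).comp (π.comp τ)
  let ψ : Rp p →+* AlgebraicClosure (ZMod p) := Ideal.Quotient.lift _ ψ0 (by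
    intro x hx
    obtain ⟨c, rfl⟩ := Ideal.mem_span_singleton.1 hx
    rw [map_mul, map_natCast, CharP.cast_eq_zero, zero_mul])
  refine ⟨{ ψ with commutes' := fun r => ?_ }, ?_⟩
  · exact RingHom.congr_fun (Subsingleton.elim (ψ.comp (algebraMap _ _)) (algebraMap _ _)) r
  · change φ (π (τ zZ)) = _
    rw [hτ, map_pow, map_pow]

/-- Fix a prime `p`. The rings `R_p` and the countable power `𝔽̄_p^ℕ` are
existentially equivalent in the language of rings: every finite system of integer
polynomial equations and inequations is solvable in one iff it is solvable in the other. -/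
theorem stmt6 (p : ℕ) [hp : Fact p.Prime] (m n : ℕ)
    (f g : Fin n → MvPolynomial (Fin m) ℤ) :
    (∃ x : Fin m → Rp p, ∀ i : Fin n,
        MvPolynomial.aeval x (f i) = 0 ∧ MvPolynomial.aeval x (g i) ≠ 0) ↔
    (∃ x : Fin m → (ℕ → AlgebraicClosure (ZMod p)), ∀ i : Fin n,
        MvPolynomial.aeval x (f i) = 0 ∧ MvPolynomial.aeval x (g i) ≠ 0) := by
  have := Rp_charP p
  let _ : Algebra (ZMod p) (Rp p) := ZMod.algebra _ p
  exact ⟨aux_forward (Rp p) (Rp_frob p) m n f g, aux_backward (Rp p) (Rp_homs p) m n f g⟩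

end
end

section
/- Let p be a prime, m ≥ 1 a natural number, and q = p^m. Let 𝓞 be the ring of integers of the (q−1)-st cyclotomic field ℚ(ζ_{q−1}). Then m divides φ(q−1), where φ is Euler's totient function, and there is a ring isomorphism 𝓞/p𝓞 ≅ (𝔽_q)^r where 𝔽_q is the field with q = p^m elements and r = φ(q−1)/m. -/
set_option synthInstance.maxHeartbeats 1000000
set_option maxHeartbeats 1000000

noncomputable section

/-- `q - 1 = p^m - 1` as a positive natural number. -/
def qSubOne (p m : ℕ) (hp : p.Prime) (hm : 1 ≤ m) : ℕ+ :=
  ⟨p ^ m - 1, by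
    have h1 : 1 < p ^ m := Nat.one_lt_pow (by omega) hp.one_lt
    omega⟩

theorem orderOf_aux (p m : ℕ) (hp : p.Prime) (hm : 1 ≤ m) :
    orderOf (p : ZMod (p ^ m - 1)) = m := by
  have h1 : 1 < p ^ m := Nat.one_lt_pow (by omega) hp.one_lt
  rw [orderOf_eq_iff (by omega)]
  have key : ∀ d, ((p : ZMod (p ^ m - 1)) ^ d = 1 ↔ (p ^ m - 1) ∣ p ^ d - 1) := by
    intro d
    have h2 : 1 ≤ p ^ d := Nat.one_le_pow _ _ hp.pos
    rw [← ZMod.natCast_eq_zero_iff, Nat.cast_sub h2, sub_eq_zero]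
    push_cast
    rfl
  refine ⟨(key m).2 dvd_rfl, fun d hd hd0 h => ?_⟩
  have h3 := (key d).1 h
  have h2 : 1 < p ^ d := Nat.one_lt_pow (by omega) hp.one_lt
  have h4 : p ^ d < p ^ m := Nat.pow_lt_pow_right hp.one_lt hd
  have := Nat.le_of_dvd (by omega) h3
  omega

open NumberField Ideal UniqueFactorizationMonoid in
theorem main_aux (p m n : ℕ) [hp : Fact p.Prime] (hm : 1 ≤ m) (hn : n = p ^ m - 1)
    [NeZero n] (K : Type) [Field K] [NumberField K]
    [hK : IsCyclotomicExtension {n} ℚ K] :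
    m ∣ Nat.totient n ∧ Nonempty ((𝓞 K ⧸ Ideal.span {(p : 𝓞 K)}) ≃+*
      (Fin (Nat.totient n / m) → GaloisField p m)) := by
  have h1 : 1 < p ^ m := Nat.one_lt_pow (by omega) hp.out.one_lt
  have hord : orderOf (p : ZMod n) = m := by subst hn; exact orderOf_aux p m hp.out hm
  have hpn : ¬ p ∣ n := by
    intro h
    have h2 : p ∣ p ^ m := dvd_pow_self p (by omega)
    have : p ∣ 1 := by
      have := (Nat.dvd_sub h2 h)
      rwa [hn, Nat.sub_sub_self h1.le] at this
    exact hp.out.not_dvd_one this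
  have : IsGalois ℚ K := IsCyclotomicExtension.isGalois {n} ℚ K
  set pp : Ideal ℤ := span {(p : ℤ)} with hpp
  have hp0 : pp ≠ ⊥ := by simp [hpp, hp.out.ne_zero]
  have hmax : pp.IsMaximal := Int.ideal_span_isMaximal_of_prime p
  have h_main := ncard_primesOver_mul_ramificationIdxIn_mul_inertiaDegIn pp (𝓞 K) Gal(K/ℚ)
  rw [IsCyclotomicExtension.Rat.ramificationIdxIn_eq_of_not_dvd p K hpn,
    IsCyclotomicExtension.Rat.inertiaDegIn_eq_of_not_dvd p K hpn, hord, one_mul,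
    IsGaloisGroup.card_eq_finrank Gal(K/ℚ) ℚ K,
    IsCyclotomicExtension.finrank (n := n) K
      (Polynomial.cyclotomic.irreducible_rat (NeZero.pos n))] at h_main
  refine ⟨⟨_, by rw [mul_comm]; exact h_main.symm⟩, ?_⟩
  have hmap : pp.map (algebraMap ℤ (𝓞 K)) = span {(p : 𝓞 K)} := by
    simp [hpp, Ideal.map_span]
  have hmap0 : pp.map (algebraMap ℤ (𝓞 K)) ≠ ⊥ := Ideal.map_ne_bot_of_ne_bot hp0
  have hmem : ∀ P : Ideal (𝓞 K), P ∈ (factors (pp.map (algebraMap ℤ (𝓞 K)))).toFinset →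
      P.IsPrime ∧ P.LiesOver pp := fun P hP =>
    (IsDedekindDomain.mem_primesOverFinset_iff hp0 _).mp hP
  have hcard : Fintype.card (factors (pp.map (algebraMap ℤ (𝓞 K)))).toFinset
      = Nat.totient n / m := by
    rw [Fintype.card_coe, ← h_main, Nat.mul_div_cancel _ (by omega), ← Set.ncard_coe_finset]
    congr 1
    exact IsDedekindDomain.coe_primesOverFinset hp0 _
  have e1 := IsDedekindDomain.quotientEquivPiFactors hmap0
  have e2 : ∀ P : (factors (pp.map (algebraMap ℤ (𝓞 K)))).toFinset,
      Nonempty ((𝓞 K ⧸ (P : Ideal (𝓞 K)) ^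
        (factors (pp.map (algebraMap ℤ (𝓞 K)))).count (P : Ideal (𝓞 K))) ≃+*
        GaloisField p m) := by
    rintro ⟨P, hP⟩
    obtain ⟨hP1, hP2⟩ := hmem P hP
    have hc : (factors (pp.map (algebraMap ℤ (𝓞 K)))).count P = 1 := by
      rw [factors_eq_normalizedFactors,
        ← IsDedekindDomain.ramificationIdx_eq_normalizedFactors_count pp P hmap0]
      exact IsCyclotomicExtension.Rat.ramificationIdx_eq_of_not_dvd p K P hpn
    have hf := pow_inertiaDeg p P
    rw [IsCyclotomicExtension.Rat.inertiaDeg_eq_of_not_dvd p K P hpn, hord] at hf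
    have hPmax : P.IsMaximal := .of_liesOver_isMaximal P pp
    let : Field (𝓞 K ⧸ P) := Ideal.Quotient.field P
    have hcard' : Nat.card (𝓞 K ⧸ P) = p ^ m := hf.symm
    have : Finite (𝓞 K ⧸ P) := Nat.finite_of_card_ne_zero (by omega)
    let := Fintype.ofFinite (𝓞 K ⧸ P)
    let := Fintype.ofFinite (GaloisField p m)
    have e : (𝓞 K ⧸ P) ≃+* GaloisField p m := FiniteField.ringEquivOfCardEq (by
      rw [← Nat.card_eq_fintype_card, ← Nat.card_eq_fintype_card, hcard',
        GaloisField.card p m (by omega)])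
    exact ⟨(Ideal.quotEquivOfEq (by simp only [hc, pow_one])).trans e⟩
  have e3 := fun P => (e2 P).some
  rw [← hmap]
  exact ⟨(e1.trans (RingEquiv.piCongrRight e3)).trans
    (RingEquiv.piCongrLeft (fun _ => GaloisField p m) (Fintype.equivFinOfCardEq hcard))⟩

theorem cyc_aux (n : ℕ) (K : Type) [Field K] [CharZero K] (a b : Algebra ℚ K)
    (h : @IsCyclotomicExtension {n} ℚ K _ _ a) : @IsCyclotomicExtension {n} ℚ K _ _ b := by
  have : a = b := Subsingleton.elim _ _
  exact this ▸ h

/-- Let `p` be a prime, `m ≥ 1` and `q = p^m`. Let `𝓞` be the ring of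
integers of the `(q-1)`-st cyclotomic field `ℚ(ζ_{q-1})`. Then `m` divides `φ(q-1)` and
`𝓞/p𝓞 ≅ (𝔽_q)^r` with `r = φ(q-1)/m`, where `𝔽_q` is the field with `q = p^m` elements. -/
theorem stmt7 (p m : ℕ) (hp : p.Prime) (hm : 1 ≤ m) :
    m ∣ Nat.totient (p ^ m - 1) ∧
    Nonempty
      ((NumberField.RingOfIntegers (CyclotomicField (qSubOne p m hp hm) ℚ) ⧸
          Ideal.span
            {(p : NumberField.RingOfIntegers (CyclotomicField (qSubOne p m hp hm) ℚ))}) ≃+*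
        (Fin (Nat.totient (p ^ m - 1) / m) → @GaloisField p ⟨hp⟩ m)) := by
  have : Fact p.Prime := ⟨hp⟩
  have : NeZero ((qSubOne p m hp hm : ℕ+) : ℕ) := ⟨(qSubOne p m hp hm).ne_zero⟩
  have hcyc : IsCyclotomicExtension {((qSubOne p m hp hm : ℕ+) : ℕ)} ℚ
      (CyclotomicField (qSubOne p m hp hm) ℚ) := by
    exact cyc_aux _ _ _ _ <| CyclotomicField.isCyclotomicExtension ((qSubOne p m hp hm : ℕ+) : ℕ) ℚ
  exact main_aux p m (qSubOne p m hp hm : ℕ+) hm rfl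
    (CyclotomicField (qSubOne p m hp hm) ℚ)

end
end

section
/- Fix a prime p and natural numbers n, m ≥ 1, and let f_1,…,f_n, g_1,…,g_n ∈ 𝔽̄_p[x_1,…,x_m] be polynomials with coefficients in 𝔽̄_p. Let A_p = 𝔽̄_p[t^{1/p^∞}]/(t^{p−1}). Let K be ANY algebraically closed field equipped with a structure of 𝔽̄_p-algebra (in particular K has characteristic p) and with a nontrivial valuation v : K → Γ₀. Then the system f_1(x) = … = f_n(x) = 0, g_1(x) ≠ 0, …, g_n(x) ≠ 0 has a solution x ∈ A_p^m if and only if there exists x ∈ K^m with all entries in 𝒪_v such that v(f_i(x)) < v(g_j(x)) for all 1 ≤ i, j ≤ n (where the coefficients of f_i, g_j are mapped into K via the algebra structure). -/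
noncomputable section

/-- The ring hom `R[X]/(X^a) →+* R[X]/(X^b)` induced by `X ↦ X^k`, well defined when
`b ≤ a * k`. -/
noncomputable def powQuotMap (R : Type*) [CommRing R] (a b k : ℕ) (h : b ≤ a * k) :
    (Polynomial R ⧸ Ideal.span {(Polynomial.X : Polynomial R) ^ a}) →+*
      (Polynomial R ⧸ Ideal.span {(Polynomial.X : Polynomial R) ^ b}) :=
  Ideal.Quotient.lift _
    ((Ideal.Quotient.mk _).comp (Polynomial.eval₂RingHom Polynomial.C (Polynomial.X ^ k)))
    (fun f hf => by
      rw [Ideal.mem_span_singleton] at hf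
      obtain ⟨g, rfl⟩ := hf
      simp only [RingHom.comp_apply, Polynomial.coe_eval₂RingHom, Polynomial.eval₂_mul,
        Polynomial.eval₂_pow, Polynomial.eval₂_X]
      rw [← pow_mul, Ideal.Quotient.eq_zero_iff_mem]
      exact Ideal.mul_mem_right _ _
        (Ideal.mem_span_singleton.2 (pow_dvd_pow _ (le_trans h (le_of_eq (mul_comm a k))))))

/-- `R[t^{1/p^∞}]/(t^{p-1})`: the direct limit over `n : ℕ` of the rings
`R[X]/(X^{p^n(p-1)})`, with transition maps induced by `X ↦ X^p`
(from stage `n` to stage `m` the map is induced by `X ↦ X^{p^{m-n}}`). -/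
noncomputable abbrev PerfQuot (R : Type*) [CommRing R] (p : ℕ) : Type _ :=
  Ring.DirectLimit
    (fun n : ℕ => Polynomial R ⧸ Ideal.span {(Polynomial.X : Polynomial R) ^ (p ^ n * (p - 1))})
    (fun n m hnm => powQuotMap R (p ^ n * (p - 1)) (p ^ m * (p - 1)) (p ^ (m - n))
      (le_of_eq (by rw [mul_right_comm, ← pow_add, Nat.add_sub_cancel' hnm])))

/-- The canonical ring hom `R →+* R[t^{1/p^∞}]/(t^{p-1})` (constants, via stage `0`). -/
noncomputable def toPerfQuot (R : Type*) [CommRing R] (p : ℕ) : R →+* PerfQuot R p :=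
  (Ring.DirectLimit.of _ _ 0).comp ((Ideal.Quotient.mk _).comp Polynomial.C)


theorem ka_len {R M : Type*} [CommRing R] [IsDomain R] [AddCommGroup M] [Module R M]
    (hlen : ∀ I : Ideal R, I ≠ ⊥ → Module.length R (R ⧸ I) ≠ ⊤)
    (ψ : M →ₗ[R] R) (hψ : Function.Injective ψ) (a : R) (ha : a ≠ 0) :
    Module.length R (M ⧸ LinearMap.range (LinearMap.lsmul R M a)) ≤
      Module.length R (R ⧸ Ideal.span {a}) := by
  by_cases hM : Subsingleton M
  · have : Subsingleton (M ⧸ LinearMap.range (LinearMap.lsmul R M a)) :=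
      (Submodule.mkQ_surjective _).subsingleton
    rw [Module.length_eq_zero]; exact zero_le
  have hI : LinearMap.range ψ ≠ ⊥ := by
    intro h
    apply hM
    refine ⟨fun x y => hψ ?_⟩
    rw [LinearMap.range_eq_bot] at h
    simp [h]
  set I : Ideal R := LinearMap.range ψ with hIdef
  set T : Ideal R := Submodule.map (LinearMap.lsmul R R a) I with hT
  have hTm : ∀ x, x ∈ T ↔ ∃ m, a * ψ m = x := by
    intro x; simp [hT, hIdef, Submodule.mem_map]
  -- first sequence
  have e1 : Module.length R (R ⧸ T) =
      Module.length R (M ⧸ LinearMap.range (LinearMap.lsmul R M a)) + Module.length R (R ⧸ I) := by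
    refine Module.length_eq_add_of_exact
      (Submodule.mapQ (LinearMap.range (LinearMap.lsmul R M a)) T ψ ?_)
      (Submodule.factor (p := T) (p' := I) ?_) ?_ ?_ ?_
    · rintro _ ⟨m, rfl⟩
      exact (hTm _).2 ⟨m, by simp⟩
    · intro x hx
      obtain ⟨m, rfl⟩ := (hTm _).1 hx
      exact ⟨a • m, by simp⟩
    · rw [injective_iff_map_eq_zero]
      intro x hx
      obtain ⟨m, rfl⟩ := Submodule.mkQ_surjective _ x
      simp only [Submodule.mkQ_apply, Submodule.mapQ_apply, Submodule.Quotient.mk_eq_zero] at hx ⊢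
      obtain ⟨m', h⟩ := (hTm _).1 hx
      exact ⟨m', hψ (by simpa using h)⟩
    · exact Submodule.factor_surjective _
    · intro x
      obtain ⟨x, rfl⟩ := Submodule.mkQ_surjective _ x
      rw [Submodule.factor_mk, Submodule.mkQ_apply, Submodule.mkQ_apply, Submodule.Quotient.mk_eq_zero]
      constructor
      · rintro ⟨m, rfl⟩
        exact ⟨Submodule.Quotient.mk m, by simp⟩
      · rintro ⟨y, hy⟩
        obtain ⟨m, rfl⟩ := Submodule.mkQ_surjective _ y
        simp only [Submodule.mkQ_apply, Submodule.mapQ_apply] at hy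
        rw [Submodule.Quotient.eq] at hy
        obtain ⟨m', h⟩ := (hTm _).1 hy
        exact ⟨m - a • m', by simp [h]⟩
  have e2 : Module.length R (R ⧸ T) =
      Module.length R (R ⧸ I) + Module.length R (R ⧸ Ideal.span {a}) := by
    refine Module.length_eq_add_of_exact
      (Submodule.mapQ I T (LinearMap.lsmul R R a) ?_)
      (Submodule.factor (p := T) (p' := Ideal.span {a}) ?_) ?_ ?_ ?_
    · intro x hx
      exact (hTm _).2 (by obtain ⟨m, rfl⟩ := hx; exact ⟨m, by simp⟩)
    · intro x hx
      obtain ⟨m, rfl⟩ := (hTm _).1 hx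
      exact Ideal.mul_mem_right _ _ (Ideal.mem_span_singleton_self a)
    · rw [injective_iff_map_eq_zero]
      intro x hx
      obtain ⟨m, rfl⟩ := Submodule.mkQ_surjective _ x
      simp only [Submodule.mkQ_apply, Submodule.mapQ_apply, Submodule.Quotient.mk_eq_zero] at hx ⊢
      obtain ⟨m', h⟩ := (hTm _).1 hx
      exact ⟨m', mul_left_cancel₀ ha (by simpa using h)⟩
    · exact Submodule.factor_surjective _
    · intro x
      obtain ⟨x, rfl⟩ := Submodule.mkQ_surjective _ x
      rw [Submodule.factor_mk, Submodule.mkQ_apply, Submodule.mkQ_apply, Submodule.Quotient.mk_eq_zero,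
        Ideal.mem_span_singleton]
      constructor
      · rintro ⟨m, rfl⟩
        exact ⟨Submodule.Quotient.mk m, rfl⟩
      · rintro ⟨y, hy⟩
        obtain ⟨m, rfl⟩ := Submodule.mkQ_surjective _ y
        simp only [Submodule.mkQ_apply, Submodule.mapQ_apply] at hy
        rw [Submodule.Quotient.eq] at hy
        obtain ⟨m', h⟩ := (hTm _).1 hy
        refine ⟨m - ψ m', ?_⟩
        simp at h
        linear_combination h
  rw [e2, add_comm] at e1
  exact ((ENat.add_left_injective_of_ne_top (hlen I hI)) e1).ge

theorem noeth_of_len {R W : Type*} [CommRing R] [AddCommGroup W] [Module R W] (l : ℕ∞) (hl : l ≠ ⊤)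
    (h : ∀ N : Submodule R W, N.FG → Module.length R N ≤ l) : IsNoetherian R W := by
  classical
  lift l to ℕ using hl
  have hfin : ∀ N : Submodule R W, N.FG → ∃ k : ℕ, k ≤ l ∧ Module.length R N = k := by
    intro N hN
    have := h N hN
    have h2 : Module.length R N ≠ ⊤ := fun e => by simp [e] at this
    obtain ⟨k, hk⟩ := ENat.ne_top_iff_exists.1 h2
    refine ⟨k, ?_, hk.symm⟩
    rw [← hk] at this
    exact_mod_cast this
  let P : ℕ → Prop := fun k => ∃ N : Submodule R W, N.FG ∧ Module.length R N = k
  have hP0 : P 0 := ⟨⊥, Submodule.fg_bot, by simp⟩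
  have hPg := Nat.findGreatest_spec (P := P) (Nat.zero_le l) hP0
  obtain ⟨N, hN, hNl⟩ := hPg
  have htop : N = ⊤ := by
    rw [eq_top_iff]
    intro x _
    have hfg : (N ⊔ Submodule.span R {x}).FG := hN.sup (Submodule.fg_span_singleton x)
    obtain ⟨k, hk, hk2⟩ := hfin _ hfg
    have hle : k ≤ Nat.findGreatest P l := Nat.le_findGreatest hk ⟨_, hfg, hk2⟩
    by_contra hx
    have hlen : IsFiniteLength R (N ⊔ Submodule.span R {x} : Submodule R W) :=
      Module.length_ne_top_iff.1 (by simp [hk2])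
    obtain ⟨_, _⟩ := isFiniteLength_iff_isNoetherian_isArtinian.1 hlen
    have hlt := Submodule.length_lt (R := R) (M := (N ⊔ Submodule.span R {x} : Submodule R W))
      (N := N.submoduleOf _) (by
        intro e
        rw [Submodule.submoduleOf_eq_top] at e
        exact hx (e (Submodule.mem_sup_right (Submodule.mem_span_singleton_self x))))
    rw [(Submodule.submoduleOfEquivOfLe (le_sup_left : N ≤ N ⊔ Submodule.span R {x})).length_eq,
      hNl, hk2] at hlt
    have : Nat.findGreatest P l < k := by exact_mod_cast hlt
    omega
  have : IsFiniteLength R N := Module.length_ne_top_iff.1 (by rw [hNl]; simp)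
  obtain ⟨_, _⟩ := isFiniteLength_iff_isNoetherian_isArtinian.1 this
  subst htop
  exact isNoetherian_of_linearEquiv (Submodule.topEquiv (R := R) (M := W))

theorem ka_noeth {R V L : Type*} [CommRing R] [IsDomain R] [AddCommGroup V] [Module R V]
    [Field L] [Algebra R L] [IsFractionRing R L]
    (hlen : ∀ I : Ideal R, I ≠ ⊥ → Module.length R (R ⧸ I) ≠ ⊤)
    (φ : V →ₗ[R] L) (hφ : Function.Injective φ) (a : R) (ha : a ≠ 0) :
    IsNoetherian R (V ⧸ LinearMap.range (LinearMap.lsmul R V a)) := by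
  refine noeth_of_len (Module.length R (R ⧸ Ideal.span {a})) (hlen _ (by simpa using ha)) ?_
  intro N hN
  obtain ⟨M, hM, rfl⟩ : ∃ M : Submodule R V, M.FG ∧
      M.map (LinearMap.range (LinearMap.lsmul R V a)).mkQ = N := by
    classical
    obtain ⟨s, rfl⟩ := hN
    obtain ⟨t, rfl⟩ : ∃ t : Finset V, t.image (LinearMap.range (LinearMap.lsmul R V a)).mkQ = s := by
      refine ⟨s.image (Function.surjInv (Submodule.mkQ_surjective _)), ?_⟩
      rw [Finset.image_image]
      have : ((LinearMap.range (LinearMap.lsmul R V a)).mkQ ∘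
          Function.surjInv (Submodule.mkQ_surjective _)) = id := by
        ext x
        exact Function.surjInv_eq (Submodule.mkQ_surjective _) x
      rw [this, Finset.image_id]
    refine ⟨Submodule.span R t, ⟨t, rfl⟩, ?_⟩
    rw [Submodule.map_span, Finset.coe_image]
  obtain ⟨d, hd, hdM⟩ := FractionalIdeal.isFractional_of_fg (S := nonZeroDivisors R) (P := L)
    (hM.map φ)
  have hd0 : d ≠ 0 := nonZeroDivisors.ne_zero hd
  have hinj : Function.Injective (Algebra.linearMap R L) := IsFractionRing.injective R L
  let e := LinearEquiv.ofInjective (Algebra.linearMap R L) hinj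
  let ψ₀ : M →ₗ[R] LinearMap.range (Algebra.linearMap R L) :=
    LinearMap.codRestrict _ (d • (φ ∘ₗ M.subtype)) (by
      rintro ⟨m, hm⟩
      obtain ⟨r, hr⟩ := hdM (φ m) (Submodule.mem_map_of_mem hm)
      exact ⟨r, by simpa using hr⟩)
  have hψ₀ : Function.Injective ψ₀ := by
    rw [injective_iff_map_eq_zero]
    rintro ⟨m, hm⟩ h
    have h1 : d • φ m = 0 := congrArg Subtype.val h
    rw [Algebra.smul_def, mul_eq_zero] at h1
    rcases h1 with h1 | h1
    · exact absurd ((map_eq_zero_iff _ (IsFractionRing.injective R L)).1 h1) hd0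
    · have := (map_eq_zero_iff φ hφ).1 h1
      exact Subtype.ext this
  have key := ka_len (M := M) hlen (e.symm.toLinearMap ∘ₗ ψ₀) (e.symm.injective.comp hψ₀) a ha
  refine le_trans ?_ key
  refine Module.length_le_of_surjective (Submodule.liftQ _
    (((LinearMap.range (LinearMap.lsmul R V a)).mkQ.domRestrict M).codRestrict _ ?_) ?_) ?_
  · rintro ⟨m, hm⟩
    exact Submodule.mem_map_of_mem hm
  · rintro _ ⟨m, rfl⟩
    rw [LinearMap.mem_ker]
    apply Subtype.ext
    change Submodule.Quotient.mk (a • (m : V)) = 0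
    rw [Submodule.Quotient.mk_eq_zero]
    exact ⟨m, rfl⟩
  · rintro ⟨_, m, hm, rfl⟩
    exact ⟨Submodule.Quotient.mk ⟨m, hm⟩, rfl⟩
open IsLocalRing

theorem dim_one_of_G {R : Type*} [CommRing R] [IsDomain R] [IsNoetherianRing R] [IsLocalRing R]
    (G : R) (hG : G ≠ 0)
    (h : ∀ P : Ideal R, P.IsPrime → P ≠ ⊥ → P ≠ maximalIdeal R → G ∈ P)
    (P : Ideal R) (hP : P.IsPrime) (hP0 : P ≠ ⊥) : P = maximalIdeal R := by
  by_contra hne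
  have hlt : P < maximalIdeal R := lt_of_le_of_ne (le_maximalIdeal hP.ne_top) hne
  have hGP := h P hP hP0 hne
  -- a minimal prime is not the maximal ideal
  have hfin := Ideal.finite_minimalPrimes_of_isNoetherianRing R (Ideal.span {G})
  have h1 : ∀ Q ∈ (Ideal.span {G}).minimalPrimes, ¬ maximalIdeal R ≤ Q := by
    intro Q hQ hle
    have : Q = maximalIdeal R := le_antisymm (le_maximalIdeal hQ.1.1.ne_top) hle
    subst this
    exact absurd (hQ.2 ⟨hP, by simpa using hGP⟩ hlt.le) hlt.not_ge
  have h2 : ¬ ((maximalIdeal R : Set R) ⊆ ⋃ Q ∈ (Ideal.span {G}).minimalPrimes, (Q : Set R)) := by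
    have := Ideal.subset_union_prime_finite (s := (Ideal.span {G}).minimalPrimes) (f := fun Q => Q)
      hfin ⊥ ⊥ (fun Q hQ _ _ => hQ.1.1) (I := maximalIdeal R)
    rw [this]
    rintro ⟨Q, hQ, hle⟩
    exact h1 Q hQ hle
  obtain ⟨b, hb, hbQ⟩ := Set.not_subset.1 h2
  simp only [Set.mem_iUnion, not_exists] at hbQ
  have hb0 : b ≠ 0 := by
    rintro rfl
    obtain ⟨Q, hQ, _⟩ := Ideal.exists_minimalPrimes_le (I := Ideal.span {G}) (J := P) (by simpa using hGP)
    exact hbQ Q hQ (zero_mem _)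
  obtain ⟨Q', hQ', hle⟩ := Ideal.exists_minimalPrimes_le (I := Ideal.span {b}) (J := maximalIdeal R)
    (by simpa using hb)
  have hQp : Q'.IsPrime := hQ'.1.1
  have hht := Ideal.height_le_one_of_isPrincipal_of_mem_minimalPrimes (Ideal.span {b}) Q' hQ'
  have hbQ' : b ∈ Q' := hQ'.1.2 (Ideal.mem_span_singleton_self b)
  -- no nonzero prime strictly below
  have hno : ∀ P' : Ideal R, P'.IsPrime → P' ≠ ⊥ → ¬ P' < Q' := by
    intro P' hP' h0 hlt'
    have hQp : Q'.IsPrime := hQ'.1.1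
    have a1 : P'.height + 1 ≤ Q'.height := Ideal.height_add_one_le_of_lt_of_isPrime hlt'
    have a2 : (⊥ : Ideal R).height + 1 ≤ P'.height :=
      Ideal.height_add_one_le_of_lt_of_isPrime (bot_lt_iff_ne_bot.2 h0)
    have a3 : (1 : ℕ∞) + 1 ≤ 1 := by
      calc (1 : ℕ∞) + 1 ≤ P'.height + 1 := by gcongr; exact le_trans le_add_self a2
        _ ≤ 1 := a1.trans hht
    exact absurd a3 (by decide)
  have hQ'm : Q' ≠ maximalIdeal R := by
    intro e
    exact hno P hP hP0 (e ▸ hlt)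
  have hQ'0 : Q' ≠ ⊥ := by
    rintro rfl
    exact hb0 (by simpa using hbQ')
  have hGQ' := h Q' hQ'.1.1 hQ'0 hQ'm
  obtain ⟨P', hP', hP'le⟩ := Ideal.exists_minimalPrimes_le (I := Ideal.span {G}) (J := Q') (by simpa using hGQ')
  have hP'0 : P' ≠ ⊥ := by
    rintro rfl
    exact hG (by simpa using hP'.1.2 (Ideal.mem_span_singleton_self G))
  have := hno P' hP'.1.1 hP'0
  have heq : P' = Q' := by
    by_contra hne'
    exact this (lt_of_le_of_ne hP'le hne')
  exact hbQ P' hP' (heq ▸ hbQ')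

theorem exists_prime_dim_one {R : Type*} [CommRing R] [IsDomain R] [IsNoetherianRing R] [IsLocalRing R]
    (hR : maximalIdeal R ≠ ⊥) (G : R) (hG : G ≠ 0) :
    ∃ Q : Ideal R, Q.IsPrime ∧ G ∉ Q ∧ Q ≠ maximalIdeal R ∧
      ∀ P : Ideal R, P.IsPrime → Q < P → P = maximalIdeal R := by
  let S : Set (Ideal R) := {Q | Q.IsPrime ∧ G ∉ Q ∧ Q ≠ maximalIdeal R}
  have hS : S.Nonempty := ⟨⊥, Ideal.isPrime_bot, by simpa using hG, hR.symm⟩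
  obtain ⟨Q, ⟨hQ, hGQ, hQm⟩, hmax⟩ := set_has_maximal_iff_noetherian.2 (inferInstance : IsNoetherian R R) S hS
  refine ⟨Q, hQ, hGQ, hQm, ?_⟩
  intro P hP hQP
  have hloc : IsLocalRing (R ⧸ Q) := .of_surjective' (Ideal.Quotient.mk Q) Ideal.Quotient.mk_surjective
  have hlh : IsLocalHom (Ideal.Quotient.mk Q) := .of_surjective _ Ideal.Quotient.mk_surjective
  have hcm : ∀ P' : Ideal (R ⧸ Q), P'.comap (Ideal.Quotient.mk Q) = maximalIdeal R → P' = maximalIdeal (R ⧸ Q) := by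
    intro P' e
    apply Ideal.comap_injective_of_surjective _ Ideal.Quotient.mk_surjective
    rw [e]
    have := IsLocalRing.maximalIdeal_comap (Ideal.Quotient.mk Q)  
    exact this.symm
  have key := dim_one_of_G (Ideal.Quotient.mk Q G) (by rwa [Ne, Ideal.Quotient.eq_zero_iff_mem]) (by
    intro P' hP' h0 hm
    by_contra hG'
    refine hmax (P'.comap (Ideal.Quotient.mk Q)) ⟨Ideal.comap_isPrime _ _, hG', fun e => hm (hcm _ e)⟩ ?_
    refine lt_of_le_of_ne ?_ ?_
    · intro x hx
      rw [Ideal.mem_comap, Ideal.Quotient.eq_zero_iff_mem.2 hx]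
      exact zero_mem _
    · intro e
      apply h0
      apply Ideal.comap_injective_of_surjective _ Ideal.Quotient.mk_surjective
      rw [← e]
      ext x
      simp [Ideal.mem_comap, Ideal.Quotient.eq_zero_iff_mem])
    (P.map (Ideal.Quotient.mk Q)) (Ideal.map_isPrime_of_surjective Ideal.Quotient.mk_surjective (by simpa using hQP.le)) (by
      intro e
      rw [Ideal.map_eq_bot_iff_le_ker, Ideal.mk_ker] at e
      exact absurd e hQP.not_ge)
  have := congrArg (Ideal.comap (Ideal.Quotient.mk Q)) key
  rw [IsLocalRing.maximalIdeal_comap, Ideal.comap_map_of_surjective _ Ideal.Quotient.mk_surjective] at this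
  rw [← this]
  symm
  rw [sup_eq_left]
  intro x hx
  exact hQP.le (by simpa [Ideal.mem_comap, Ideal.Quotient.eq_zero_iff_mem] using hx)

theorem len_of_dim_one {R : Type*} [CommRing R] [IsDomain R] [IsNoetherianRing R] [IsLocalRing R]
    (h : ∀ P : Ideal R, P.IsPrime → P ≠ ⊥ → P = maximalIdeal R) (I : Ideal R) (hI : I ≠ ⊥) :
    Module.length R (R ⧸ I) ≠ ⊤ := by
  have : Ring.KrullDimLE 0 (R ⧸ I) := by
    refine .mk₀ fun P hP => ?_
    have h1 := h (P.comap (Ideal.Quotient.mk I)) (Ideal.comap_isPrime _ _) (by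
      intro e
      apply hI
      rw [eq_bot_iff, ← e]
      intro x hx
      rw [Ideal.mem_comap, Ideal.Quotient.eq_zero_iff_mem.2 hx]
      exact zero_mem _)
    have h2 : (P.comap (Ideal.Quotient.mk I)).IsMaximal := h1 ▸ maximalIdeal.isMaximal R
    have h3 := Ideal.map_eq_top_or_isMaximal_of_surjective (Ideal.Quotient.mk I)
      Ideal.Quotient.mk_surjective h2
    rw [Ideal.map_comap_of_surjective _ Ideal.Quotient.mk_surjective] at h3
    exact h3.resolve_left hP.ne_top
  have : IsArtinianRing (R ⧸ I) :=
    isArtinianRing_iff_isNoetherianRing_krullDimLE_zero.2 ⟨inferInstance, this⟩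
  rw [Module.length_eq_of_surjective (S := R) (R := R ⧸ I) (M := R ⧸ I)
    Ideal.Quotient.mk_surjective]
  exact Module.length_ne_top

/-- Existence of a discrete valuation ring with residue field `k`. -/
theorem exists_dvr_dim_one {k R : Type*} [Field k] [IsAlgClosed k] [CommRing R] [IsDomain R]
    [IsNoetherianRing R] [IsLocalRing R] [Algebra k R]
    (hR : maximalIdeal R ≠ ⊥)
    (hk : ∀ r : R, ∃ c : k, r - algebraMap k R c ∈ maximalIdeal R)
    (h : ∀ P : Ideal R, P.IsPrime → P ≠ ⊥ → P = maximalIdeal R) :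
    ∃ (A : ValuationSubring (FractionRing R)) (φ : R →+* A), IsDiscreteValuationRing A ∧
      Function.Injective φ ∧ (∀ r ∈ maximalIdeal R, φ r ∈ maximalIdeal A) ∧
      ∀ y : A, ∃ c : k, y - φ (algebraMap k R c) ∈ maximalIdeal A := by
  obtain ⟨A, hA, hloc⟩ := IsLocalRing.exists_factor_valuationRing (algebraMap R (FractionRing R))
  let φ : R →+* A := (algebraMap R (FractionRing R)).codRestrict A.toSubring hA
  have hφloc : IsLocalHom φ := hloc
  have hφinj : Function.Injective φ := by
    intro x y hxy
    exact IsFractionRing.injective R (FractionRing R) (congrArg Subtype.val hxy)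
  have hφm : ∀ r ∈ maximalIdeal R, φ r ∈ maximalIdeal A := by
    intro r hr
    rw [mem_maximalIdeal] at hr ⊢
    exact fun hu => hr (hφloc.map_nonunit _ hu)
  let : Algebra R A := φ.toAlgebra
  have hmap : ∀ r : R, algebraMap R A r = φ r := fun _ => rfl
  let ι : A →ₗ[R] FractionRing R :=
    { toFun := fun x => x.1
      map_add' := fun _ _ => rfl
      map_smul' := fun r x => by
        rw [Algebra.smul_def, Algebra.smul_def]; rfl }
  have hι : Function.Injective ι := Subtype.val_injective
  have hN := fun a ha => ka_noeth (R := R) (V := A) (L := FractionRing R) (len_of_dim_one h) ι hι a ha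
  -- quotient by ideals
  have hN' : ∀ (a : R), a ≠ 0 → ∀ J : Ideal A, φ a ∈ J → IsNoetherian R (A ⧸ J) := by
    intro a ha J hJ
    have := hN a ha
    refine isNoetherian_of_surjective (M := A ⧸ LinearMap.range (LinearMap.lsmul R A a))
      (Submodule.liftQ _ ((Ideal.Quotient.mkₐ R J).toLinearMap) ?_) ?_
    · rintro _ ⟨x, rfl⟩
      rw [LinearMap.mem_ker]
      change Ideal.Quotient.mk J (a • x) = 0
      rw [Ideal.Quotient.eq_zero_iff_mem, Algebra.smul_def]
      exact Ideal.mul_mem_right _ _ hJ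
    · rw [LinearMap.range_eq_top]
      intro y
      obtain ⟨y, rfl⟩ := Ideal.Quotient.mk_surjective y
      exact ⟨Submodule.Quotient.mk y, rfl⟩
  have hnoeth : IsNoetherianRing A := by
    rw [isNoetherianRing_iff_ideal_fg]
    intro I
    by_cases hI : I = ⊥
    · rw [hI]; exact Submodule.fg_bot
    obtain ⟨y, hyI, hy⟩ := Submodule.exists_mem_ne_zero_of_ne_bot hI
    obtain ⟨a, b, hb, hab⟩ := IsFractionRing.div_surjective (A := R) (y : FractionRing R)
    have hb0 : algebraMap R (FractionRing R) b ≠ 0 := by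
      simpa using nonZeroDivisors.ne_zero hb
    have hya : φ b * y = φ a := by
      apply Subtype.ext
      change algebraMap R (FractionRing R) b * (y : FractionRing R) = algebraMap R (FractionRing R) a
      rw [← hab]
      field_simp
    have ha : a ≠ 0 := by
      rintro rfl
      apply hy
      apply Subtype.ext
      simpa using hab.symm
    have haI : φ a ∈ I := hya ▸ Ideal.mul_mem_left _ _ hyI
    have h1 : IsNoetherian R (A ⧸ Ideal.span {φ a}) := hN' a ha _ (Ideal.mem_span_singleton_self _)
    have h2 : IsNoetherian A (A ⧸ Ideal.span {φ a}) := isNoetherian_of_tower R h1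
    have h3 : IsNoetherianRing (A ⧸ Ideal.span {φ a}) :=
      isNoetherian_of_tower A h2
    refine Ideal.fg_of_fg_map_of_fg_inf_ker_of_surjective (f := Ideal.Quotient.mk (Ideal.span {φ a}))
      (IsNoetherian.noetherian _) ?_ Ideal.Quotient.mk_surjective
    rw [Ideal.mk_ker, inf_eq_right.2 (by simpa [Ideal.span_le] using haI)]
    exact ⟨{φ a}, by simp⟩
  obtain ⟨a, ham, ha⟩ := Submodule.exists_mem_ne_zero_of_ne_bot hR
  have hnf : ¬ IsField A := by
    intro hf
    have := isField_iff_maximalIdeal_eq.1 hf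
    have h1 := hφm a ham
    rw [this, Ideal.mem_bot] at h1
    exact ha (hφinj (by simpa using h1))
  have hdvr : IsDiscreteValuationRing A :=
    ((IsDiscreteValuationRing.TFAE A hnf).out 0 1 :
      IsDiscreteValuationRing A ↔ ValuationRing A).2 inferInstance
  refine ⟨A, φ, hdvr, hφinj, hφm, ?_⟩
  intro y
  have h1 : IsNoetherian R (A ⧸ maximalIdeal A) := hN' a ha _ (hφm a ham)
  have h2 : Algebra.IsIntegral R (A ⧸ maximalIdeal A) := Algebra.IsIntegral.of_finite _ _
  let : Field (A ⧸ maximalIdeal A) := Ideal.Quotient.field _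
  let κ : k →+* (A ⧸ maximalIdeal A) := (Ideal.Quotient.mk _).comp (φ.comp (algebraMap k R))
  have hκint : κ.IsIntegral := by
    intro z
    obtain ⟨P, hP, hPz⟩ := h2.isIntegral z
    choose c hc using hk
    have hcz : ∀ r, κ (c r) = algebraMap R (A ⧸ maximalIdeal A) r := by
      intro r
      change Ideal.Quotient.mk _ (φ (algebraMap k R (c r))) = Ideal.Quotient.mk _ (φ r)
      symm
      rw [Ideal.Quotient.eq, ← map_sub]
      exact hφm _ (hc r)
    have hlift : P.map (algebraMap R (A ⧸ maximalIdeal A)) ∈ Polynomial.lifts κ := by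
      rw [Polynomial.lifts_iff_coeff_lifts]
      intro n
      rw [Polynomial.coeff_map]
      exact ⟨c (P.coeff n), hcz _⟩
    obtain ⟨P', hP', -, hP'm⟩ := Polynomial.lifts_and_degree_eq_and_monic hlift (hP.map _)
    refine ⟨P', hP'm, ?_⟩
    rw [← Polynomial.eval_map, hP', Polynomial.eval_map]
    exact hPz
  let : Algebra k (A ⧸ maximalIdeal A) := κ.toAlgebra
  have h3 : Algebra.IsIntegral k (A ⧸ maximalIdeal A) := ⟨hκint⟩
  obtain ⟨c, hc⟩ := (IsAlgClosed.algebraMap_bijective_of_isIntegral (k := k)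
    (K := A ⧸ maximalIdeal A)).2 (Ideal.Quotient.mk _ y)
  refine ⟨c, ?_⟩
  rw [← Ideal.Quotient.eq]
  exact hc.symm

theorem exists_dvr.{u, w} {k : Type w} {B : Type u} [Field k] [IsAlgClosed k] [CommRing B] [IsDomain B]
    [Algebra k B] [Algebra.FiniteType k B] (n : Ideal B) [hn : n.IsMaximal] (hn0 : n ≠ ⊥)
    (G : B) (hG : G ≠ 0) :
    ∃ (A : Type u) (_ : CommRing A) (_ : IsDomain A) (_ : IsDiscreteValuationRing A)
      (φ : B →+* A), φ G ≠ 0 ∧ (∀ b ∈ n, φ b ∈ maximalIdeal A) ∧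
      ∀ y : A, ∃ c : k, y - φ (algebraMap k B c) ∈ maximalIdeal A := by
  have hNB : IsNoetherianRing B := Algebra.FiniteType.isNoetherianRing k B
  -- residue field of `n`
  have hres : ∀ b : B, ∃ c : k, b - algebraMap k B c ∈ n := by
    intro b
    let : Field (B ⧸ n) := Ideal.Quotient.field n
    have hft : Algebra.FiniteType k (B ⧸ n) := inferInstance
    have hfin : Module.Finite k (B ⧸ n) := finite_of_finite_type_of_isJacobsonRing k (B ⧸ n)
    have hAlgInt : Algebra.IsIntegral k (B ⧸ n) := Algebra.IsIntegral.of_finite _ _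
    obtain ⟨c, hc⟩ := (IsAlgClosed.algebraMap_bijective_of_isIntegral (k := k)
      (K := B ⧸ n)).2 (Ideal.Quotient.mk _ b)
    refine ⟨c, ?_⟩
    rw [← Ideal.Quotient.eq]
    exact hc.symm
  let R₁ := Localization.AtPrime n
  have hR₁d : IsDomain R₁ := IsLocalization.isDomain_of_atPrime R₁ n
  have hR₁n : IsNoetherianRing R₁ := IsLocalization.isNoetherianRing n.primeCompl R₁ hNB
  have hinj : Function.Injective (algebraMap B R₁) :=
    IsLocalization.injective R₁ n.primeCompl_le_nonZeroDivisors
  have hmem : ∀ b ∈ n, algebraMap B R₁ b ∈ maximalIdeal R₁ := by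
    intro b hb
    exact (IsLocalization.AtPrime.to_map_mem_maximal_iff R₁ n b).2 hb
  have hm0 : maximalIdeal R₁ ≠ ⊥ := by
    intro e
    obtain ⟨b, hb, hb0⟩ := Submodule.exists_mem_ne_zero_of_ne_bot hn0
    have := hmem b hb
    rw [e, Ideal.mem_bot] at this
    exact hb0 (hinj (by simpa using this))
  have hk₁ : ∀ r : R₁, ∃ c : k, r - algebraMap B R₁ (algebraMap k B c) ∈ maximalIdeal R₁ := by
    intro r
    obtain ⟨b, s, rfl⟩ := IsLocalization.exists_mk'_eq n.primeCompl r
    obtain ⟨cb, hcb⟩ := hres b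
    obtain ⟨cs, hcs⟩ := hres s
    have hcs0 : cs ≠ 0 := by
      rintro rfl
      exact s.2 (by simpa using hcs)
    refine ⟨cb / cs, ?_⟩
    have e : IsLocalization.mk' R₁ b s - algebraMap B R₁ (algebraMap k B (cb / cs)) =
        IsLocalization.mk' R₁ (b - algebraMap k B (cb / cs) * s) s := by
      rw [IsLocalization.eq_mk'_iff_mul_eq, sub_mul, IsLocalization.mk'_spec, map_sub, map_mul]
    rw [e, IsLocalization.AtPrime.mk'_mem_maximal_iff R₁ n]
    have e2 : b - algebraMap k B (cb / cs) * s =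
        (b - algebraMap k B cb) - algebraMap k B (cb / cs) * (s - algebraMap k B cs) := by
      have : algebraMap k B cb = algebraMap k B (cb / cs) * algebraMap k B cs := by
        rw [← map_mul, div_mul_cancel₀ _ hcs0]
      rw [this]; ring
    rw [e2]
    exact Ideal.sub_mem _ hcb (Ideal.mul_mem_left _ _ hcs)
  obtain ⟨Q, hQ, hGQ, hQm, hQdim⟩ := exists_prime_dim_one hm0 (algebraMap B R₁ G)
    (by simpa using fun e => hG (hinj (by simpa using e)))
  let R := R₁ ⧸ Q
  have hloc : IsLocalRing R := .of_surjective' (Ideal.Quotient.mk Q) Ideal.Quotient.mk_surjective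
  have hlh : IsLocalHom (Ideal.Quotient.mk Q) := .of_surjective _ Ideal.Quotient.mk_surjective
  have hcm : (maximalIdeal R).comap (Ideal.Quotient.mk Q) = maximalIdeal R₁ :=
    IsLocalRing.maximalIdeal_comap (Ideal.Quotient.mk Q)
  have hle : ∀ P : Ideal R, Q ≤ P.comap (Ideal.Quotient.mk Q) := by
    intro P x hx
    rw [Ideal.mem_comap, Ideal.Quotient.eq_zero_iff_mem.2 hx]
    exact zero_mem _
  have hbot : (⊥ : Ideal R).comap (Ideal.Quotient.mk Q) = Q := by
    ext x
    rw [Ideal.mem_comap, Ideal.mem_bot]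
    exact Ideal.Quotient.eq_zero_iff_mem
  let : Algebra k R := ((Ideal.Quotient.mk Q).comp ((algebraMap B R₁).comp (algebraMap k B))).toAlgebra
  obtain ⟨A, φ, hA, hφi, hφm, hφr⟩ := exists_dvr_dim_one (k := k) (R := R)
    (by
      intro e
      rw [e, hbot] at hcm
      exact hQm hcm)
    (by
      intro r
      obtain ⟨r, rfl⟩ := Ideal.Quotient.mk_surjective r
      obtain ⟨c, hc⟩ := hk₁ r
      refine ⟨c, ?_⟩
      rw [← hcm, Ideal.mem_comap, map_sub] at hc
      exact hc)
    (by
      intro P hP hP0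
      apply Ideal.comap_injective_of_surjective _ Ideal.Quotient.mk_surjective
      rw [hcm]
      refine hQdim _ (Ideal.comap_isPrime _ _) (lt_of_le_of_ne (hle P) ?_)
      intro e
      apply hP0
      apply Ideal.comap_injective_of_surjective _ Ideal.Quotient.mk_surjective
      rw [hbot, ← e])
  refine ⟨A, inferInstance, inferInstance, hA,
    φ.comp ((Ideal.Quotient.mk Q).comp (algebraMap B R₁)), ?_, ?_, ?_⟩
  · intro e
    apply hGQ
    rw [← Ideal.Quotient.eq_zero_iff_mem]
    exact hφi (by simpa using e)
  · intro b hb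
    apply hφm
    have := hmem b hb
    rw [← hcm, Ideal.mem_comap] at this
    exact this
  · exact hφr

theorem approx_poly {k A : Type*} [Field k] [CommRing A] [IsDomain A] [IsDiscreteValuationRing A]
    (ρ : k →+* A) (hρ : ∀ y : A, ∃ c : k, y - ρ c ∈ maximalIdeal A) (ϖ : A) (hϖ : Irreducible ϖ)
    (N : ℕ) : ∀ y : A, ∃ P : Polynomial k, ϖ ^ N ∣ Polynomial.eval₂ ρ ϖ P - y := by
  induction N with
  | zero => intro y; exact ⟨0, by simp⟩
  | succ N ih =>
    intro y
    obtain ⟨c, hc⟩ := hρ y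
    rw [hϖ.maximalIdeal_eq, Ideal.mem_span_singleton] at hc
    obtain ⟨z, hz⟩ := hc
    obtain ⟨P, w, hw⟩ := ih z
    refine ⟨Polynomial.C c + Polynomial.X * P, w, ?_⟩
    simp only [Polynomial.eval₂_add, Polynomial.eval₂_C, Polynomial.eval₂_mul, Polynomial.eval₂_X]
    linear_combination ϖ * hw - hz

theorem ord_poly {k A : Type*} [Field k] [CommRing A] [IsDomain A] [IsDiscreteValuationRing A]
    (ρ : k →+* A) (ϖ : A) (hϖ : Irreducible ϖ) (N : ℕ) :
    ∀ P : Polynomial k, ϖ ^ N ∣ Polynomial.eval₂ ρ ϖ P ↔ Polynomial.X ^ N ∣ P := by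
  induction N with
  | zero => simp
  | succ N ih =>
    intro P
    constructor
    · intro h
      have h1 : ϖ ∣ Polynomial.eval₂ ρ ϖ P := (dvd_pow_self ϖ (Nat.succ_ne_zero N)).trans h
      have h2 : P = Polynomial.X * P.divX + Polynomial.C (P.coeff 0) := (Polynomial.X_mul_divX_add P).symm
      have h3 : P.coeff 0 = 0 := by
        by_contra hc
        rw [h2] at h1
        simp only [Polynomial.eval₂_add, Polynomial.eval₂_C, Polynomial.eval₂_mul,
          Polynomial.eval₂_X] at h1
        rw [dvd_add_right (dvd_mul_right _ _)] at h1
        exact hϖ.not_isUnit (isUnit_of_dvd_unit h1 ((IsUnit.mk0 _ hc).map ρ))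
      rw [h3, map_zero, add_zero] at h2
      rw [h2, pow_succ'] at h ⊢
      simp only [Polynomial.eval₂_mul, Polynomial.eval₂_X] at h
      exact mul_dvd_mul_left _ ((ih _).1 ((mul_dvd_mul_iff_left hϖ.ne_zero).1 h))
    · rintro ⟨Q, rfl⟩
      simp [Polynomial.eval₂_mul, Polynomial.eval₂_pow]

theorem exists_curve {k A ι σ : Type*} [Field k] [CommRing A] [IsDomain A] [IsDiscreteValuationRing A]
    [Finite ι] [Nonempty ι]
    (ρ : k →+* A) (hρ : ∀ y : A, ∃ c : k, y - ρ c ∈ maximalIdeal A)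
    (f g : ι → MvPolynomial σ k) (x : σ → A)
    (hg : ∀ j, MvPolynomial.eval₂ ρ x (g j) ≠ 0)
    (hfg : ∀ i j, ∃ h ∈ maximalIdeal A,
      MvPolynomial.eval₂ ρ x (f i) = h * MvPolynomial.eval₂ ρ x (g j)) :
    ∃ (δ : ℕ) (y : σ → Polynomial k), ∀ i,
      Polynomial.X ^ (δ + 1) ∣ MvPolynomial.eval₂ Polynomial.C y (f i) ∧
      ¬ Polynomial.X ^ (δ + 1) ∣ MvPolynomial.eval₂ Polynomial.C y (g i) := by
  obtain ⟨ϖ, hϖ⟩ := IsDiscreteValuationRing.exists_irreducible A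
  choose d hd using fun j => IsDiscreteValuationRing.associated_pow_irreducible (hg j) hϖ
  obtain ⟨j₀, hj₀⟩ := Finite.exists_max d
  choose y hy using fun l => approx_poly ρ hρ ϖ hϖ (d j₀ + 1) (x l)
  have hcong : ∀ F : MvPolynomial σ k, ϖ ^ (d j₀ + 1) ∣
      Polynomial.eval₂ ρ ϖ (MvPolynomial.eval₂ Polynomial.C y F) - MvPolynomial.eval₂ ρ x F := by
    intro F
    have e : Polynomial.eval₂ ρ ϖ (MvPolynomial.eval₂ Polynomial.C y F) =
        MvPolynomial.eval₂ ρ (fun l => Polynomial.eval₂ ρ ϖ (y l)) F := by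
      have := MvPolynomial.eval₂_comp_left (Polynomial.eval₂RingHom ρ ϖ) Polynomial.C y F
      rw [Polynomial.coe_eval₂RingHom] at this
      rw [this]
      congr 1
      ext c
      simp
    rw [e, ← Ideal.mem_span_singleton, ← Ideal.Quotient.eq, MvPolynomial.eval₂_comp_left,
      MvPolynomial.eval₂_comp_left]
    congr 1
    ext l
    simp only [Function.comp_apply]
    rw [Ideal.Quotient.eq, Ideal.mem_span_singleton]
    exact hy l
  refine ⟨d j₀, y, fun i => ⟨?_, ?_⟩⟩
  · rw [← ord_poly ρ ϖ hϖ, dvd_iff_dvd_of_dvd_sub (hcong (f i))]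
    obtain ⟨h, hm, e⟩ := hfg i j₀
    rw [hϖ.maximalIdeal_eq, Ideal.mem_span_singleton] at hm
    rw [e, pow_succ']
    exact mul_dvd_mul hm (hd j₀).symm.dvd
  · rw [← ord_poly ρ ϖ hϖ, dvd_iff_dvd_of_dvd_sub (hcong (g i))]
    intro h
    have h2 := h.trans (hd i).dvd
    rw [pow_dvd_pow_iff hϖ.ne_zero hϖ.not_isUnit] at h2
    have := hj₀ i
    omega
theorem X_pow_dvd_expand {R : Type*} [CommRing R] (b c : ℕ) (hc : 0 < c) (P : Polynomial R) :
    Polynomial.X ^ b ∣ Polynomial.expand R c P ↔ ∀ d, d * c < b → P.coeff d = 0 := by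
  rw [Polynomial.X_pow_dvd_iff]
  constructor
  · intro h d hd
    have := h (d * c) hd
    rwa [Polynomial.coeff_expand_mul hc] at this
  · intro h d hd
    rw [Polynomial.coeff_expand hc]
    split_ifs with hdvd
    · apply h
      rwa [Nat.div_mul_cancel hdvd]
    · rfl

theorem powQuotMap_mk (R : Type*) [CommRing R] (a b k : ℕ) (h : b ≤ a * k) (P : Polynomial R) :
    powQuotMap R a b k h (Ideal.Quotient.mk _ P) = Ideal.Quotient.mk _ (Polynomial.expand R k P) := by
  rfl

theorem powQuotMap_inj (R : Type*) [CommRing R] (a b k : ℕ) (hk : 0 < k) (h : b = a * k) :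
    Function.Injective (powQuotMap R a b k h.le) := by
  rw [injective_iff_map_eq_zero]
  intro x hx
  obtain ⟨P, rfl⟩ := Ideal.Quotient.mk_surjective x
  rw [powQuotMap_mk, Ideal.Quotient.eq_zero_iff_mem, Ideal.mem_span_singleton,
    X_pow_dvd_expand _ _ hk] at hx
  rw [Ideal.Quotient.eq_zero_iff_mem, Ideal.mem_span_singleton, Polynomial.X_pow_dvd_iff]
  intro d hd
  apply hx
  rw [h]
  exact Nat.mul_lt_mul_of_pos_right hd hk

/-- The map from polynomials to stage `N` of the limit. -/
def stageMap (R : Type*) [CommRing R] (p N : ℕ) : Polynomial R →+* PerfQuot R p :=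
  (Ring.DirectLimit.of _ _ N).comp (Ideal.Quotient.mk _)

theorem stageMap_expand (R : Type*) [CommRing R] (p N N' : ℕ) (h : N ≤ N') (P : Polynomial R) :
    stageMap R p N' (Polynomial.expand R (p ^ (N' - N)) P) = stageMap R p N P := by
  have := Ring.DirectLimit.of_f
    (G := fun n : ℕ => Polynomial R ⧸ Ideal.span {(Polynomial.X : Polynomial R) ^ (p ^ n * (p - 1))})
    (f := fun n m hnm => powQuotMap R (p ^ n * (p - 1)) (p ^ m * (p - 1)) (p ^ (m - n))
      (le_of_eq (by rw [mul_right_comm, ← pow_add, Nat.add_sub_cancel' hnm])))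
    h (Ideal.Quotient.mk _ P)
  rw [powQuotMap_mk] at this
  exact this

theorem stageMap_C (R : Type*) [CommRing R] (p N : ℕ) :
    (stageMap R p N).comp Polynomial.C = toPerfQuot R p := by
  ext r
  have := stageMap_expand R p 0 N (Nat.zero_le _) (Polynomial.C r)
  rw [Polynomial.expand_C] at this
  exact this

theorem stageMap_eq_zero (R : Type*) [CommRing R] (p N : ℕ) (hp : 0 < p) (P : Polynomial R) :
    stageMap R p N P = 0 ↔ Polynomial.X ^ (p ^ N * (p - 1)) ∣ P := by
  have hds : DirectedSystem
      (fun n : ℕ => Polynomial R ⧸ Ideal.span {(Polynomial.X : Polynomial R) ^ (p ^ n * (p - 1))})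
      (fun n m hnm => powQuotMap R (p ^ n * (p - 1)) (p ^ m * (p - 1)) (p ^ (m - n))
        (le_of_eq (by rw [mul_right_comm, ← pow_add, Nat.add_sub_cancel' hnm]))) := by
    refine ⟨?_, ?_⟩
    · intro i x
      obtain ⟨P, rfl⟩ := Ideal.Quotient.mk_surjective x
      rw [powQuotMap_mk, Nat.sub_self, pow_zero, Polynomial.expand_one]
    · intro l j i hij hjk x
      obtain ⟨P, rfl⟩ := Ideal.Quotient.mk_surjective x
      rw [powQuotMap_mk, powQuotMap_mk, powQuotMap_mk, Polynomial.expand_expand, ← pow_add]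
      congr 4
      omega
  have hinj := Ring.DirectLimit.of_injective
    (G := fun n : ℕ => Polynomial R ⧸ Ideal.span {(Polynomial.X : Polynomial R) ^ (p ^ n * (p - 1))})
    (f' := fun n m hnm => powQuotMap R (p ^ n * (p - 1)) (p ^ m * (p - 1)) (p ^ (m - n))
      (le_of_eq (by rw [mul_right_comm, ← pow_add, Nat.add_sub_cancel' hnm])))
    (fun i j hij => powQuotMap_inj R _ _ _ (pow_pos hp _)
      (by rw [mul_right_comm, ← pow_add, Nat.add_sub_cancel' hij])) N
  rw [← Ideal.mem_span_singleton, ← Ideal.Quotient.eq_zero_iff_mem]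
  exact map_eq_zero_iff _ hinj

theorem exists_stageMap (R : Type*) [CommRing R] (p : ℕ) (z : PerfQuot R p) :
    ∃ N P, stageMap R p N P = z := by
  obtain ⟨N, x, rfl⟩ := Ring.DirectLimit.exists_of z
  obtain ⟨P, rfl⟩ := Ideal.Quotient.mk_surjective x
  exact ⟨N, P, rfl⟩

theorem perfQuot_iff {R ι σ : Type*} [CommRing R] [Finite σ] (p : ℕ) (hp : 0 < p)
    (f g : ι → MvPolynomial σ R) :
    (∃ x : σ → PerfQuot R p, ∀ i, MvPolynomial.eval₂ (toPerfQuot R p) x (f i) = 0 ∧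
        MvPolynomial.eval₂ (toPerfQuot R p) x (g i) ≠ 0) ↔
    ∃ (N : ℕ) (y : σ → Polynomial R), ∀ i,
      Polynomial.X ^ (p ^ N * (p - 1)) ∣ MvPolynomial.eval₂ Polynomial.C y (f i) ∧
      ¬ Polynomial.X ^ (p ^ N * (p - 1)) ∣ MvPolynomial.eval₂ Polynomial.C y (g i) := by
  have key : ∀ (N : ℕ) (y : σ → Polynomial R) (F : MvPolynomial σ R),
      MvPolynomial.eval₂ (toPerfQuot R p) (fun l => stageMap R p N (y l)) F =
        stageMap R p N (MvPolynomial.eval₂ Polynomial.C y F) := by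
    intro N y F
    rw [MvPolynomial.eval₂_comp_left, stageMap_C]
    rfl
  constructor
  · rintro ⟨x, hx⟩
    choose n y hy using fun l => exists_stageMap R p (x l)
    obtain ⟨N, hN⟩ := (Set.finite_range n).bddAbove
    have hN' : ∀ l, n l ≤ N := fun l => hN ⟨l, rfl⟩
    refine ⟨N, fun l => Polynomial.expand R (p ^ (N - n l)) (y l), fun i => ?_⟩
    rw [← stageMap_eq_zero R p N hp, ← stageMap_eq_zero R p N hp, ← key, ← key]
    have : (fun l => stageMap R p N (Polynomial.expand R (p ^ (N - n l)) (y l))) = x := by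
      ext l
      rw [stageMap_expand R p _ _ (hN' l), hy]
    rw [this]
    exact hx i
  · rintro ⟨N, y, h⟩
    refine ⟨fun l => stageMap R p N (y l), fun i => ?_⟩
    rw [key, key, stageMap_eq_zero R p N hp, Ne, stageMap_eq_zero R p N hp]
    exact h i

theorem exists_rescale {k ι σ : Type*} [CommRing k] (p : ℕ) (hp : p.Prime)
    (f g : ι → MvPolynomial σ k) (δ : ℕ) (y : σ → Polynomial k)
    (h : ∀ i, Polynomial.X ^ (δ + 1) ∣ MvPolynomial.eval₂ Polynomial.C y (f i) ∧
      ¬ Polynomial.X ^ (δ + 1) ∣ MvPolynomial.eval₂ Polynomial.C y (g i)) :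
    ∃ (N : ℕ) (y : σ → Polynomial k), ∀ i,
      Polynomial.X ^ (p ^ N * (p - 1)) ∣ MvPolynomial.eval₂ Polynomial.C y (f i) ∧
      ¬ Polynomial.X ^ (p ^ N * (p - 1)) ∣ MvPolynomial.eval₂ Polynomial.C y (g i) := by
  let N := (δ + 1) * (δ + 1)
  have hM : (δ + 1) * (δ + 1) ≤ p ^ N * (p - 1) := by
    have h1 : N < p ^ N := Nat.lt_pow_self hp.one_lt
    have h2 : 1 ≤ p - 1 := by have := hp.two_le; omega
    calc (δ + 1) * (δ + 1) ≤ p ^ N * 1 := by rw [mul_one]; exact h1.le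
      _ ≤ _ := Nat.mul_le_mul_left _ h2
  generalize hMdef : p ^ N * (p - 1) = M at hM
  obtain ⟨c, hc0, hc1, hc2⟩ : ∃ c, 0 < c ∧ M ≤ (δ + 1) * c ∧ δ * c < M := by
    have hq : δ + 1 ≤ M / (δ + 1) := (Nat.le_div_iff_mul_le (Nat.succ_pos _)).2 hM
    have hr := Nat.div_add_mod M (δ + 1)
    have hr2 : M % (δ + 1) < δ + 1 := Nat.mod_lt M (Nat.succ_pos δ)
    refine ⟨M / (δ + 1) + 1, Nat.succ_pos _, ?_, ?_⟩
    · rw [mul_add]; omega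
    · generalize M / (δ + 1) = q at *
      generalize M % (δ + 1) = r at *
      rw [add_mul] at hr
      rw [mul_add]
      omega
  have key : ∀ F : MvPolynomial σ k,
      MvPolynomial.eval₂ Polynomial.C (fun l => Polynomial.expand k c (y l)) F =
        Polynomial.expand k c (MvPolynomial.eval₂ Polynomial.C y F) := by
    intro F
    have := MvPolynomial.eval₂_comp_left (Polynomial.expand k c : Polynomial k →+* Polynomial k) Polynomial.C y F
    rw [RingHom.coe_coe] at this
    rw [this]
    congr 1
    ext r : 1
    simp
  refine ⟨N, fun l => Polynomial.expand k c (y l), fun i => ?_⟩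
  rw [key, key, hMdef, X_pow_dvd_expand _ _ hc0, X_pow_dvd_expand _ _ hc0]
  obtain ⟨h1, h2⟩ := h i
  rw [Polynomial.X_pow_dvd_iff] at h1 h2
  refine ⟨fun d hd => h1 d ?_, fun hh => h2 fun d hd => hh d ?_⟩
  · by_contra hlt
    have : (δ + 1) * c ≤ d * c := Nat.mul_le_mul_right _ (by omega)
    omega
  · have : d * c ≤ δ * c := Nat.mul_le_mul_right _ (by omega)
    omega

theorem val_const (p : ℕ) [hp : Fact p.Prime] {K Γ₀ : Type*} [Field K]
    [Algebra (AlgebraicClosure (ZMod p)) K] [LinearOrderedCommGroupWithZero Γ₀]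
    (v : Valuation K Γ₀) (c : AlgebraicClosure (ZMod p)) (hc : c ≠ 0) :
    v (algebraMap _ K c) = 1 := by
  obtain ⟨N, hN, h⟩ : ∃ N, N ≠ 0 ∧ c ^ N = 1 := by
    let L := IntermediateField.adjoin (ZMod p) {c}
    have hfd : FiniteDimensional (ZMod p) L :=
      IntermediateField.adjoin.finiteDimensional (Algebra.IsIntegral.isIntegral c)
    have hfin : Finite L := Module.finite_of_finite (ZMod p)
    let c' : L := ⟨c, IntermediateField.mem_adjoin_simple_self _ c⟩
    have hc' : c' ≠ 0 := fun e => hc (congrArg Subtype.val e)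
    obtain ⟨N, hN, h⟩ := isOfFinOrder_iff_pow_eq_one.1 (isOfFinOrder_of_finite (Units.mk0 c' hc'))
    refine ⟨N, hN.ne', ?_⟩
    have := congrArg (fun u : Lˣ => ((u : L) : AlgebraicClosure (ZMod p))) h
    simpa [c'] using this
  have h2 : v (algebraMap _ K c) ^ N = 1 := by
    rw [← map_pow, ← map_pow, h, map_one, map_one]
  exact (pow_eq_one_iff_of_nonneg zero_le' hN).1 h2

theorem val_const_le (p : ℕ) [hp : Fact p.Prime] {K Γ₀ : Type*} [Field K]
    [Algebra (AlgebraicClosure (ZMod p)) K] [LinearOrderedCommGroupWithZero Γ₀]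
    (v : Valuation K Γ₀) (c : AlgebraicClosure (ZMod p)) :
    v (algebraMap _ K c) ≤ 1 := by
  by_cases hc : c = 0
  · rw [hc, map_zero, map_zero]; exact zero_le'
  · exact (val_const p v c hc).le

theorem val_poly_le (p : ℕ) [hp : Fact p.Prime] {K Γ₀ : Type*} [Field K]
    [Algebra (AlgebraicClosure (ZMod p)) K] [LinearOrderedCommGroupWithZero Γ₀]
    (v : Valuation K Γ₀) (a : K) (ha : v a ≤ 1)
    (P : Polynomial (AlgebraicClosure (ZMod p))) : v (Polynomial.aeval a P) ≤ 1 := by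
  rw [Polynomial.aeval_eq_sum_range]
  refine v.map_sum_le fun i _ => ?_
  rw [Algebra.smul_def, map_mul, map_pow]
  exact mul_le_one' (val_const_le p v _) (pow_le_one' ha _)

theorem val_poly_lt (p : ℕ) [hp : Fact p.Prime] {K Γ₀ : Type*} [Field K]
    [Algebra (AlgebraicClosure (ZMod p)) K] [LinearOrderedCommGroupWithZero Γ₀]
    (v : Valuation K Γ₀) (a : K) (ha0 : v a ≠ 0) (ha : v a < 1) (M : ℕ) :
    ∀ P : Polynomial (AlgebraicClosure (ZMod p)), ¬ Polynomial.X ^ M ∣ P →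
      v a ^ M < v (Polynomial.aeval a P) := by
  induction M with
  | zero => intro P hP; exact absurd (by simp) hP
  | succ M ih =>
    intro P hP
    have e := Polynomial.X_mul_divX_add P
    have hev : Polynomial.aeval a P = a * Polynomial.aeval a P.divX +
        algebraMap _ K (P.coeff 0) := by
      have e2 := congrArg (Polynomial.aeval a) e
      rw [map_add, map_mul, Polynomial.aeval_X, Polynomial.aeval_C] at e2
      exact e2.symm
    by_cases h0 : P.coeff 0 = 0
    · rw [h0, map_zero, add_zero] at hev
      rw [hev, map_mul, pow_succ']
      refine mul_lt_mul_of_pos_left (ih _ fun hd => hP ?_) (zero_lt_iff.2 ha0)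
      rw [← e, h0, map_zero, add_zero, pow_succ']
      exact mul_dvd_mul_left _ hd
    · have h1 : v (a * Polynomial.aeval a P.divX) < v (algebraMap _ K (P.coeff 0)) := by
        rw [val_const p v _ h0, map_mul]
        exact mul_lt_one_of_lt_of_le ha (val_poly_le p v a ha.le _)
      rw [hev, v.map_add_eq_of_lt_right h1, val_const p v _ h0]
      exact pow_lt_one₀ zero_le' ha (Nat.succ_ne_zero _)

theorem exists_small {K Γ₀ : Type*} [Field K] [LinearOrderedCommGroupWithZero Γ₀]
    (v : Valuation K Γ₀) (hv : ∃ a : K, v a ≠ 0 ∧ v a ≠ 1) : ∃ a : K, v a ≠ 0 ∧ v a < 1 := by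
  obtain ⟨a, h0, h1⟩ := hv
  rcases lt_or_gt_of_ne h1 with h | h
  · exact ⟨a, h0, h⟩
  · refine ⟨a⁻¹, ?_, ?_⟩
    · rw [map_inv₀]; exact inv_ne_zero h0
    · rw [map_inv₀]; exact inv_lt_one_of_one_lt₀ h

theorem forward_dir (p : ℕ) [hp : Fact p.Prime] {ι σ K Γ₀ : Type*} [Field K]
    [Algebra (AlgebraicClosure (ZMod p)) K] [LinearOrderedCommGroupWithZero Γ₀]
    (f g : ι → MvPolynomial σ (AlgebraicClosure (ZMod p)))
    (v : Valuation K Γ₀) (hv : ∃ a : K, v a ≠ 0 ∧ v a ≠ 1) (M : ℕ)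
    (y : σ → Polynomial (AlgebraicClosure (ZMod p)))
    (h : ∀ i, Polynomial.X ^ M ∣ MvPolynomial.eval₂ Polynomial.C y (f i) ∧
      ¬ Polynomial.X ^ M ∣ MvPolynomial.eval₂ Polynomial.C y (g i)) :
    ∃ x : σ → K, (∀ l, v (x l) ≤ 1) ∧ ∀ i j,
      v (MvPolynomial.aeval x (f i)) < v (MvPolynomial.aeval x (g j)) := by
  obtain ⟨a, ha0, ha⟩ := exists_small v hv
  have key : ∀ F : MvPolynomial σ (AlgebraicClosure (ZMod p)),
      MvPolynomial.aeval (fun l => Polynomial.aeval a (y l)) F =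
        Polynomial.aeval a (MvPolynomial.eval₂ Polynomial.C y F) := by
    intro F
    induction F using MvPolynomial.induction_on with
    | C r => simp
    | add P Q hP hQ => simp [hP, hQ]
    | mul_X P l hP => simp [hP]
  refine ⟨fun l => Polynomial.aeval a (y l), fun l => val_poly_le p v a ha.le _, fun i j => ?_⟩
  rw [key, key]
  refine lt_of_le_of_lt ?_ (val_poly_lt p v a ha0 ha M _ (h j).2)
  obtain ⟨Q, hQ⟩ := (h i).1
  rw [hQ, map_mul, map_mul, map_pow, map_pow, Polynomial.aeval_X]
  exact mul_le_of_le_one_right' (val_poly_le p v a ha.le Q)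

theorem backward_dir (p : ℕ) [hp : Fact p.Prime] {ι σ K Γ₀ : Type*} [Field K]
    [Algebra (AlgebraicClosure (ZMod p)) K] [LinearOrderedCommGroupWithZero Γ₀]
    [Finite ι] [Nonempty ι] [Finite σ]
    (f g : ι → MvPolynomial σ (AlgebraicClosure (ZMod p)))
    (v : Valuation K Γ₀) (hv : ∃ a : K, v a ≠ 0 ∧ v a ≠ 1)
    (x : σ → K) (hx : ∀ l, v (x l) ≤ 1) (hfg : ∀ i j,
      v (MvPolynomial.aeval x (f i)) < v (MvPolynomial.aeval x (g j))) :
    ∃ (δ : ℕ) (y : σ → Polynomial (AlgebraicClosure (ZMod p))), ∀ i,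
      Polynomial.X ^ (δ + 1) ∣ MvPolynomial.eval₂ Polynomial.C y (f i) ∧
      ¬ Polynomial.X ^ (δ + 1) ∣ MvPolynomial.eval₂ Polynomial.C y (g i) := by
  have := Fintype.ofFinite ι
  obtain ⟨a, ha0, ha⟩ := exists_small v hv
  have hg0 : ∀ j, MvPolynomial.aeval x (g j) ≠ 0 := by
    intro j e
    have := hfg j j
    rw [e, map_zero] at this
    exact not_lt_zero' this
  let h : ι × ι → K := fun ij => MvPolynomial.aeval x (f ij.1) / MvPolynomial.aeval x (g ij.2)
  have hh : ∀ ij, v (h ij) < 1 := by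
    intro ij
    rw [map_div₀]
    exact (div_lt_one₀ (zero_lt_iff.2 (v.ne_zero_iff.2 (hg0 ij.2)))).2 (hfg _ _)
  let S : Set K := (Set.range x ∪ Set.range h) ∪ {a}
  have hSf : S.Finite := ((Set.finite_range x).union (Set.finite_range h)).union
    (Set.finite_singleton a)
  let B := Algebra.adjoin (AlgebraicClosure (ZMod p)) S
  have hBft : Algebra.FiniteType (AlgebraicClosure (ZMod p)) B :=
    (Subalgebra.fg_iff_finiteType B).1 (Subalgebra.fg_def.2 ⟨S, hSf, rfl⟩)
  have hB1 : ∀ b ∈ B, v b ≤ 1 := by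
    intro b hb
    induction hb using Algebra.adjoin_induction with
    | mem s hs =>
      rcases hs with (⟨l, rfl⟩ | ⟨ij, rfl⟩) | rfl
      · exact hx l
      · exact (hh ij).le
      · exact ha.le
    | algebraMap r => exact val_const_le p v r
    | add s t _ _ hs ht => exact (v.map_add s t).trans (max_le hs ht)
    | mul s t _ _ hs ht => rw [map_mul]; exact mul_le_one' hs ht
  let q : Ideal B :=
    { carrier := {b | v (b : K) < 1}
      zero_mem' := by simp
      add_mem' := by
        intro s t hs ht
        exact lt_of_le_of_lt (v.map_add (s : K) t) (max_lt hs ht)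
      smul_mem' := by
        intro s t ht
        show v ((s : K) * t) < 1
        rw [map_mul, mul_comm]
        exact mul_lt_one_of_lt_of_le ht (hB1 s s.2) }
  have hq : q ≠ ⊤ := by
    intro e
    have : (1 : B) ∈ q := e ▸ Submodule.mem_top
    have h1 : v ((1 : B) : K) < 1 := this
    simp at h1
  obtain ⟨n, hn, hqn⟩ := Ideal.exists_le_maximal q hq
  have haB : a ∈ B := Algebra.subset_adjoin (Or.inr rfl)
  have hxB : ∀ l, x l ∈ B := fun l => Algebra.subset_adjoin (Or.inl (Or.inl ⟨l, rfl⟩))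
  have hhB : ∀ ij, h ij ∈ B := fun ij => Algebra.subset_adjoin (Or.inl (Or.inr ⟨ij, rfl⟩))
  have hn0 : n ≠ ⊥ := by
    intro e
    have h1 : (⟨a, haB⟩ : B) ∈ n := hqn (show v a < 1 from ha)
    rw [e, Ideal.mem_bot] at h1
    have h2 : a = 0 := congrArg Subtype.val h1
    exact ha0 (by rw [h2, map_zero])
  let xB : σ → B := fun l => ⟨x l, hxB l⟩
  have hcoe : ∀ F : MvPolynomial σ (AlgebraicClosure (ZMod p)),
      ((MvPolynomial.aeval xB F : B) : K) = MvPolynomial.aeval x F := by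
    intro F
    have := MvPolynomial.aeval_algebraMap_apply K xB F
    exact this.symm
  have hgB : ∀ j, MvPolynomial.aeval xB (g j) ≠ 0 := by
    intro j e
    apply hg0 j
    rw [← hcoe, e]
    rfl
  obtain ⟨A, _, _, _, φ, hφG, hφn, hφr⟩ := exists_dvr (k := AlgebraicClosure (ZMod p)) n hn0
    (∏ j, MvPolynomial.aeval xB (g j)) (Finset.prod_ne_zero_iff.2 fun j _ => hgB j)
  have hev : ∀ F : MvPolynomial σ (AlgebraicClosure (ZMod p)),
      MvPolynomial.eval₂ (φ.comp (algebraMap _ B)) (fun l => φ (xB l)) F =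
        φ (MvPolynomial.aeval xB F) := by
    intro F
    rw [MvPolynomial.aeval_def, MvPolynomial.eval₂_comp_left]
    rfl
  refine exists_curve (φ.comp (algebraMap _ B)) hφr f g (fun l => φ (xB l)) ?_ ?_
  · intro j e
    rw [hev] at e
    apply hφG
    rw [map_prod]
    exact Finset.prod_eq_zero (Finset.mem_univ j) e
  · intro i j
    refine ⟨φ ⟨h (i, j), hhB _⟩, hφn _ (hqn (hh (i, j))), ?_⟩
    rw [hev, hev, ← map_mul]
    congr 1
    apply Subtype.ext
    rw [hcoe]
    show _ = h (i, j) * ((MvPolynomial.aeval xB (g j) : B) : K)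
    rw [hcoe]
    exact (div_mul_cancel₀ _ (hg0 j)).symm

/-- Fix a prime `p`, `n, m ≥ 1` and polynomials `f i, g i` over `𝔽̄_p`.
Let `A_p = 𝔽̄_p[t^{1/p^∞}]/(t^{p-1})` and let `K` be any algebraically closed field which
is an `𝔽̄_p`-algebra, with a nontrivial valuation `v`. The system `f i = 0, g i ≠ 0` has a
solution in `A_p^m` iff there is `x ∈ 𝒪_v^m` with `v (f i x) < v (g j x)` for all `i, j`. -/
theorem stmt9 (p : ℕ) [hp : Fact p.Prime] (n m : ℕ) (hn : 1 ≤ n) (hm : 1 ≤ m)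
    (f g : Fin n → MvPolynomial (Fin m) (AlgebraicClosure (ZMod p)))
    (K : Type*) [Field K] [IsAlgClosed K] [Algebra (AlgebraicClosure (ZMod p)) K]
    (Γ₀ : Type*) [LinearOrderedCommGroupWithZero Γ₀]
    (v : Valuation K Γ₀) (hv : ∃ a : K, v a ≠ 0 ∧ v a ≠ 1) :
    (∃ x : Fin m → PerfQuot (AlgebraicClosure (ZMod p)) p, ∀ i : Fin n,
        MvPolynomial.eval₂ (toPerfQuot (AlgebraicClosure (ZMod p)) p) x (f i) = 0 ∧
        MvPolynomial.eval₂ (toPerfQuot (AlgebraicClosure (ZMod p)) p) x (g i) ≠ 0) ↔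
    (∃ x : Fin m → K, (∀ l, v (x l) ≤ 1) ∧
        ∀ i j : Fin n,
          v (MvPolynomial.aeval x (f i)) < v (MvPolynomial.aeval x (g j))) := by
  have : Nonempty (Fin n) := ⟨⟨0, hn⟩⟩
  rw [perfQuot_iff p hp.out.pos]
  constructor
  · rintro ⟨N, y, h⟩
    exact forward_dir p f g v hv _ y h
  · rintro ⟨x, hx, hfg⟩
    obtain ⟨δ, y, h⟩ := backward_dir p f g v hv x hx hfg
    exact exists_rescale p hp.out f g δ y h

end
end

section
/- Let R be a commutative ring, m a natural number, and ι any index type. Then there is a ring isomorphism ((∏_{i ∈ ι} R)[X])/(X^m) ≅ ∏_{i ∈ ι} (R[X]/(X^m)), i.e. the quotient of the polynomial ring over the product ring R^ι by the ideal generated by X^m is isomorphic to the product over ι of the quotients R[X]/(X^m). -/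
noncomputable section

/-- For a commutative ring `R`, a natural number `m` and an index type
`ι`, there is a ring isomorphism `((∏_{i ∈ ι} R)[X])/(X^m) ≅ ∏_{i ∈ ι} (R[X]/(X^m))`. -/
theorem stmt12 (R : Type*) [CommRing R] (m : ℕ) (ι : Type*) :
    Nonempty
      ((Polynomial (ι → R) ⧸ Ideal.span {(Polynomial.X : Polynomial (ι → R)) ^ m}) ≃+*
        (ι → Polynomial R ⧸ Ideal.span {(Polynomial.X : Polynomial R) ^ m})) := by
  let φ : Polynomial (ι → R) →+*
      (ι → Polynomial R ⧸ Ideal.span {(Polynomial.X : Polynomial R) ^ m}) :=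
    Pi.ringHom fun i => (Ideal.Quotient.mk _).comp
      (Polynomial.mapRingHom (Pi.evalRingHom (fun _ : ι => R) i))
  have hφ : ∀ p i, φ p i = Ideal.Quotient.mk _
      (Polynomial.map (Pi.evalRingHom (fun _ : ι => R) i) p) := fun _ _ => rfl
  have hker : Ideal.span {(Polynomial.X : Polynomial (ι → R)) ^ m} = RingHom.ker φ := by
    ext p
    rw [Ideal.mem_span_singleton, Polynomial.X_pow_dvd_iff, RingHom.mem_ker, funext_iff]
    simp only [hφ, Pi.zero_apply, Ideal.Quotient.eq_zero_iff_mem, Ideal.mem_span_singleton,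
      Polynomial.X_pow_dvd_iff, Polynomial.coeff_map, Pi.evalRingHom_apply]
    constructor
    · intro h i d hd
      rw [h d hd, Pi.zero_apply]
    · intro h d hd
      funext i
      exact h i d hd
  have hsurj : Function.Surjective φ := by
    intro g
    choose p hp using fun i => Ideal.Quotient.mk_surjective (g i)
    refine ⟨∑ k ∈ Finset.range m, Polynomial.monomial k (fun i => (p i).coeff k), ?_⟩
    funext i
    rw [hφ, ← hp i, Ideal.Quotient.eq, Ideal.mem_span_singleton, Polynomial.X_pow_dvd_iff]
    intro d hd
    simp [Polynomial.coeff_monomial, Polynomial.finset_sum_coeff, hd]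
  exact ⟨(Ideal.quotEquivOfEq hker).trans (RingHom.quotientKerEquivOfSurjective hsurj)⟩

end
end
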